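/- arXiv:0712.4279 — 2 statements merged into one kernel-verified Lean document; each statement's English description precedes it below -/
import Mathlib

section
/- Let φ : {-1,1}^m → ℝ with ‖φ‖₁ := Σ_z |φ(z)| = 1, and suppose all Fourier coefficients φ̂(T) vanish for |T| ≤ d. If M ≥ 2e(k−1)2^{2^{k−1}}m/d, then the (k,M)-pattern tensor A of c·φ with c = 2^m/size(A) satisfies μ*(A) ≤ 2^{−d}. -/
open scoped BigOperators

/-- Index set of a `(k,M)`-pattern tensor with `k1 = k-1`: a pair of `x`, consisting of `m`
blocks each a `(k-1)`-dimensional side-`M` tensor of bits, and of `k-1` index vectors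
`y_j ∈ [M]^m`. -/
abbrev PatIdx (k1 m M : ℕ) :=
  (Fin m → (Fin k1 → Fin M) → Bool) × (Fin k1 → Fin m → Fin M)

/-- Cylinder intersections on the pattern-tensor index set: `Z = Z₀ ∩ ⋂_j Z_j` where
membership in `Z₀` does not depend on the `x`-coordinate, and membership in `Z_j` does not
depend on the coordinate `y_j`. -/
def IsCylIntP (k1 m M : ℕ) (Z : Set (PatIdx k1 m M)) : Prop :=
  ∃ (Z0 : Set (PatIdx k1 m M)) (ZY : Fin k1 → Set (PatIdx k1 m M)),
    (∀ x x' y, (x, y) ∈ Z0 → (x', y) ∈ Z0) ∧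
    (∀ j, ∀ x y y', (∀ j', j' ≠ j → y j' = y' j') → (x, y) ∈ ZY j → (x, y') ∈ ZY j) ∧
    Z = Z0 ∩ ⋂ j, ZY j

/-- The dual cylinder intersection norm `μ*(Q) = max_Z |⟨Q, χ(Z)⟩|`. -/
noncomputable def mustarP {k1 m M : ℕ} (Q : PatIdx k1 m M → ℝ) : ℝ :=
  sSup {r : ℝ | ∃ Z : Set (PatIdx k1 m M), IsCylIntP k1 m M Z ∧
    r = |∑ p, Q p * Z.indicator 1 p|}

/-- The `(k,M)`-pattern tensor of `φ`: its entry at `(x, y₁, …, y_{k-1})` is `φ` applied to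
the `m` bits `x^i[y₁[i], …, y_{k-1}[i]]`. -/
def pattP {k1 m M : ℕ} (φ : (Fin m → Bool) → ℝ) (p : PatIdx k1 m M) : ℝ :=
  φ (fun i => p.1 i (fun j => p.2 j i))

section ptHelpers
open Finset


section analytic
variable {X Y : Type} [Fintype X] [Fintype Y]

lemma pt_cs {ι : Type} [Fintype ι] (w f : ι → ℝ) (hw : ∀ i, |w i| ≤ 1) :
    (𝔼 i, w i * f i) ^ 2 ≤ 𝔼 i, f i ^ 2 := by
  have h1 := Finset.expect_mul_sq_le_sq_mul_sq (univ : Finset ι) w f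
  have h2 : 𝔼 i, w i ^ 2 ≤ (1:ℝ) := by
    rw [Fintype.expect_eq_sum_div_card]
    rcases isEmpty_or_nonempty ι with h | h
    · simp
    · rw [div_le_one (by exact_mod_cast Fintype.card_pos)]
      calc ∑ i, w i ^ 2 ≤ ∑ i : ι, (1:ℝ) := by
            apply Finset.sum_le_sum
            intro i _
            rw [← sq_abs]
            exact pow_le_one₀ (abs_nonneg _) (hw i)
        _ = _ := by simp
  have h3 : 0 ≤ 𝔼 i, f i ^ 2 := Finset.expect_nonneg (fun i _ => sq_nonneg _)
  nlinarith

lemma pt_sq {ι : Type} [Fintype ι] (f : ι → ℝ) :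
    (𝔼 a, f a) ^ 2 = 𝔼 a, 𝔼 a', f a * f a' := by
  rw [sq, Finset.expect_mul_expect]

lemma pt_prod {ι κ : Type} [Fintype ι] [Fintype κ] (f : ι → κ → ℝ) :
    𝔼 a, 𝔼 b, f a b = 𝔼 p : ι × κ, f p.1 p.2 := by
  rw [← Finset.univ_product_univ, Finset.expect_product]

lemma pt_cs2 {ι κ : Type} [Fintype ι] [Fintype κ] (w f : ι → κ → ℝ)
    (hw : ∀ i j, |w i j| ≤ 1) :
    (𝔼 i, 𝔼 j, w i j * f i j) ^ 2 ≤ 𝔼 i, 𝔼 j, f i j ^ 2 := by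
  rw [pt_prod, pt_prod]
  exact pt_cs (fun p : ι × κ => w p.1 p.2) (fun p => f p.1 p.2) (fun p => hw _ _)

lemma pt_fin4 (F : (Fin 4 → Y) → ℝ) :
    𝔼 f, F f = 𝔼 a, 𝔼 b, 𝔼 c, 𝔼 d, F ![a, b, c, d] := by
  rw [pt_prod (fun a b => 𝔼 c, 𝔼 d, F ![a, b, c, d]),
    pt_prod (fun (p : Y × Y) c => 𝔼 d, F ![p.1, p.2, c, d]),
    pt_prod (fun (p : (Y × Y) × Y) d => F ![p.1.1, p.1.2, p.2, d])]
  refine Fintype.expect_equiv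
    { toFun := fun f => (((f 0, f 1), f 2), f 3)
      invFun := fun q => ![q.1.1.1, q.1.1.2, q.1.2, q.2]
      left_inv := ?_
      right_inv := ?_ } _ _ ?_
  · intro f; ext i; fin_cases i <;> rfl
  · rintro ⟨⟨⟨a, b⟩, c⟩, d⟩; rfl
  · intro f
    congr 1
    ext i; fin_cases i <;> rfl

lemma pt_pi {ι κ : Type} [Fintype ι] [DecidableEq ι] [Fintype κ] (h : ι → κ → ℝ) :
    𝔼 f : ι → κ, ∏ i, h i (f i) = ∏ i, 𝔼 a, h i a := by
  simp_rw [Fintype.expect_eq_sum_div_card]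
  rw [Finset.prod_div_distrib, Finset.prod_univ_sum, Fintype.piFinset_univ]
  simp

lemma pt_fin4_mul (f0 f1 f2 f3 : Y → ℝ) :
    𝔼 v : Fin 4 → Y, (f0 (v 0) * f1 (v 1) * (f3 (v 3) * f2 (v 2))) =
      (𝔼 a, f0 a) * (𝔼 a, f1 a) * ((𝔼 a, f3 a) * (𝔼 a, f2 a)) := by
  have := pt_pi (ι := Fin 4) (fun i => ![f0, f1, f2, f3] i)
  simp only [Fin.prod_univ_four, Matrix.cons_val_zero, Matrix.cons_val_one, Matrix.cons_val] at this
  rw [mul_comm (𝔼 a, f3 a), ← mul_assoc, ← this]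
  refine Finset.expect_congr rfl fun v _ => ?_
  ring

lemma pt_base (g : X → Y → Y → ℝ) (s t : X → Y → ℝ)
    (hs : ∀ x v, |s x v| ≤ 1) (ht : ∀ x u, |t x u| ≤ 1) :
    (𝔼 x, 𝔼 u, 𝔼 v, g x u v * s x v * t x u) ^ 8 ≤
      𝔼 u : Fin 4 → Y, 𝔼 v : Fin 4 → Y,
        |𝔼 x, ∏ q : Fin 4, ∏ b : Bool, g x (u (q + if b then 1 else 0)) (v q)| := by
  set B : X → Y → Y → ℝ := fun x u u' => 𝔼 v, g x u v * g x u' v with hB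
  set B2 : X → Y → Y → ℝ := fun x u' u'' => 𝔼 u, B x u u' * B x u u'' with hB2
  set I := 𝔼 x, 𝔼 u, 𝔼 v, g x u v * s x v * t x u with hI
  have e1 : I ^ 2 ≤ 𝔼 x, 𝔼 u, t x u * 𝔼 u', t x u' * B x u u' := by
    have : I = 𝔼 x, 𝔼 v, s x v * 𝔼 u, g x u v * t x u := by
      rw [hI]
      refine Finset.expect_congr rfl fun x _ => ?_
      rw [Finset.expect_comm]
      refine Finset.expect_congr rfl fun v _ => ?_
      rw [Finset.mul_expect]
      refine Finset.expect_congr rfl fun u _ => ?_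
      ring
    rw [this]
    refine (pt_cs2 _ _ hs).trans (le_of_eq ?_)
    refine Finset.expect_congr rfl fun x _ => ?_
    simp_rw [pt_sq]
    rw [Finset.expect_comm]
    refine Finset.expect_congr rfl fun u _ => ?_
    rw [Finset.expect_comm, Finset.mul_expect]
    refine Finset.expect_congr rfl fun u' _ => ?_
    simp only [hB]
    rw [Finset.mul_expect, Finset.mul_expect]
    refine Finset.expect_congr rfl fun v _ => ?_
    ring
  have e2 : (𝔼 x, 𝔼 u, t x u * 𝔼 u', t x u' * B x u u') ^ 2 ≤
      𝔼 x, 𝔼 u, 𝔼 u', (t x u * t x u') * B2 x u u' := by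
    refine (pt_cs2 _ _ ht).trans (le_of_eq ?_)
    refine Finset.expect_congr rfl fun x _ => ?_
    simp_rw [pt_sq]
    rw [Finset.expect_comm]
    refine Finset.expect_congr rfl fun u _ => ?_
    rw [Finset.expect_comm]
    refine Finset.expect_congr rfl fun u' _ => ?_
    simp only [hB2]
    rw [Finset.mul_expect]
    refine Finset.expect_congr rfl fun v _ => ?_
    ring
  have e3 : (𝔼 x, 𝔼 u, 𝔼 u', (t x u * t x u') * B2 x u u') ^ 2 ≤
      𝔼 x, 𝔼 u, 𝔼 u', B2 x u u' ^ 2 := by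
    have := pt_cs2 (fun x (p : Y × Y) => t x p.1 * t x p.2) (fun x p => B2 x p.1 p.2)
      (fun x p => by
        rw [abs_mul]; exact mul_le_one₀ (ht _ _) (abs_nonneg _) (ht _ _))
    simpa only [pt_prod] using this
  have e4 : I ^ 8 ≤ 𝔼 x, 𝔼 u, 𝔼 u', B2 x u u' ^ 2 := by
    have a1 : I ^ 4 ≤ (𝔼 x, 𝔼 u, t x u * 𝔼 u', t x u' * B x u u') ^ 2 := by
      calc I ^ 4 = (I ^ 2) ^ 2 := by ring
        _ ≤ _ := pow_le_pow_left₀ (sq_nonneg _) e1 2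
    have a2 := a1.trans e2
    calc I ^ 8 = (I ^ 4) ^ 2 := by ring
      _ ≤ _ := pow_le_pow_left₀ (by positivity) a2 2
      _ ≤ _ := e3
  refine e4.trans ?_
  have e5 : 𝔼 x, 𝔼 u, 𝔼 u', B2 x u u' ^ 2 = 𝔼 u : Fin 4 → Y, 𝔼 v : Fin 4 → Y,
        𝔼 x, ∏ q : Fin 4, ∏ b : Bool, g x (u (q + if b then 1 else 0)) (v q) := by
    have : ∀ u v : Fin 4 → Y, ∀ x, ∏ q : Fin 4, ∏ b : Bool, g x (u (q + if b then 1 else 0)) (v q)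
      = (g x (u 1) (v 0) * g x (u 0) (v 0)) * (g x (u 1) (v 1) * g x (u 2) (v 1)) *
        ((g x (u 3) (v 3) * g x (u 0) (v 3)) * (g x (u 3) (v 2) * g x (u 2) (v 2))) := by
      intro u v x
      simp [Fin.prod_univ_four]
      ring
    simp_rw [this]
    have : ∀ u : Fin 4 → Y, 𝔼 v : Fin 4 → Y, 𝔼 x, (g x (u 1) (v 0) * g x (u 0) (v 0)) * (g x (u 1) (v 1) * g x (u 2) (v 1)) *
        ((g x (u 3) (v 3) * g x (u 0) (v 3)) * (g x (u 3) (v 2) * g x (u 2) (v 2)))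
        = 𝔼 x, (B x (u 1) (u 0) * B x (u 1) (u 2)) * (B x (u 3) (u 0) * B x (u 3) (u 2)) := by
      intro u
      rw [Finset.expect_comm]
      refine Finset.expect_congr rfl fun x _ => ?_
      exact pt_fin4_mul (fun a => g x (u 1) a * g x (u 0) a) (fun a => g x (u 1) a * g x (u 2) a)
        (fun a => g x (u 3) a * g x (u 2) a) (fun a => g x (u 3) a * g x (u 0) a)
    simp_rw [this]
    conv_rhs => rw [Finset.expect_comm]
    refine Finset.expect_congr rfl fun x _ => ?_
    conv_rhs => rw [pt_fin4]
    refine Finset.expect_congr rfl fun u _ => ?_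
    conv_rhs => rw [Finset.expect_comm]
    refine Finset.expect_congr rfl fun u' _ => ?_
    simp only [hB2]
    rw [pt_sq]
    rfl
  rw [e5]
  exact Finset.expect_le_expect fun u _ => Finset.expect_le_expect fun v _ => le_abs_self _

lemma pt_cons {n : ℕ} {α : Type} [Fintype α] (F : (Fin (n + 1) → α) → ℝ) :
    𝔼 f, F f = 𝔼 a, 𝔼 f : Fin n → α, F (Fin.cons a f) := by
  rw [pt_prod (fun a (f : Fin n → α) => F (Fin.cons a f))]
  exact (Fintype.expect_equiv (Fin.consEquiv (fun _ => α)) _ _ (fun p => rfl)).symm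

lemma pt_prodcons {n : ℕ} {α : Type} [Fintype α] (F : (Fin (n + 1) → α) → ℝ) :
    ∏ f, F f = ∏ f : Fin n → α, ∏ a, F (Fin.cons a f) := by
  rw [← Fintype.prod_prod_type_right (fun p : α × (Fin n → α) => F (Fin.cons p.1 p.2))]
  exact (Fintype.prod_equiv (Fin.consEquiv (fun _ => α)) _ _ (fun p => rfl)).symm

lemma pt_bool (F : (Bool → Y) → ℝ) :
    𝔼 f, F f = 𝔼 a, 𝔼 a', F (fun b => if b then a' else a) := by
  rw [pt_prod (fun a a' => F (fun b => if b then a' else a))]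
  refine Fintype.expect_equiv
    { toFun := fun f => (f false, f true)
      invFun := fun q b => if b then q.2 else q.1
      left_inv := ?_
      right_inv := ?_ } _ _ ?_
  · intro f; ext i; cases i <;> rfl
  · rintro ⟨a, b⟩; rfl
  · intro f
    congr 1
    ext i; cases i <;> rfl

/-- weighted Jensen -/
lemma pt_jensen {ι : Type} [Fintype ι] [Nonempty ι] (r f : ι → ℝ) (hr : ∀ i, 1 ≤ r i)
    (N : ℕ) (hN : 8 ≤ N) (hev : Even N) :
    (𝔼 i, f i) ^ N ≤ (𝔼 i, r i) ^ N * 𝔼 i, (r i)⁻¹ ^ 7 * f i ^ N := by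
  have hV : 1 ≤ 𝔼 i, r i := by
    calc (1:ℝ) = 𝔼 i : ι, (1:ℝ) := by simp
      _ ≤ _ := Finset.expect_le_expect fun i _ => hr i
  have hS : (0:ℝ) < ∑ i, r i := by
    apply Finset.sum_pos
    · intro i _; linarith [hr i]
    · exact Finset.univ_nonempty
  have hc : (0:ℝ) < Fintype.card ι := by exact_mod_cast Fintype.card_pos
  have hVS : 𝔼 i, r i = (∑ i, r i) / Fintype.card ι := Fintype.expect_eq_sum_div_card _
  have key := Real.pow_arith_mean_le_arith_mean_pow_of_even univ
    (fun i => r i / ∑ i, r i) (fun i => f i / r i * 𝔼 i, r i)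
    (fun i _ => div_nonneg (by linarith [hr i]) hS.le)
    (by rw [← Finset.sum_div, div_self hS.ne']) hev
  have e1 : ∑ i, (r i / ∑ i, r i) * (f i / r i * 𝔼 i, r i) = 𝔼 i, f i := by
    rw [Fintype.expect_eq_sum_div_card f, Finset.sum_div]
    refine Finset.sum_congr rfl fun i _ => ?_
    have : r i ≠ 0 := by linarith [hr i]
    rw [hVS]
    field_simp
  rw [e1] at key
  refine key.trans ?_
  rw [Fintype.expect_eq_sum_div_card (fun i => (r i)⁻¹ ^ 7 * f i ^ N), Finset.sum_div,
    Finset.mul_sum]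
  refine Finset.sum_le_sum fun i _ => ?_
  have hri : 0 < r i := by linarith [hr i]
  have hf : 0 ≤ f i ^ N := hev.pow_nonneg _
  have hV0 : 0 ≤ (𝔼 i, r i) ^ N := by positivity
  obtain ⟨K, rfl⟩ := Nat.exists_eq_add_of_le hN
  have e2 : r i / (∑ i, r i) * (f i / r i * 𝔼 i, r i) ^ (8 + K)
      = (𝔼 i, r i) ^ (8 + K) * ((r i)⁻¹ ^ 7 * f i ^ (8 + K)) * ((r i)⁻¹ ^ K * (∑ i, r i)⁻¹) := by
    rw [mul_pow, div_pow, inv_pow, inv_pow]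
    field_simp
    ring
  rw [e2]
  have e3 : (r i)⁻¹ ^ K * (∑ i, r i)⁻¹ ≤ (Fintype.card ι : ℝ)⁻¹ := by
    have h1 : (r i)⁻¹ ^ K ≤ 1 := pow_le_one₀ (by positivity) (inv_le_one_of_one_le₀ (hr i))
    have h2 : (∑ i, r i)⁻¹ ≤ (Fintype.card ι : ℝ)⁻¹ := by
      apply inv_anti₀ hc
      rw [hVS, le_div_iff₀ hc] at hV
      linarith
    have h3 : 0 ≤ (∑ i, r i)⁻¹ := by positivity
    calc _ ≤ 1 * (∑ i, r i)⁻¹ := by gcongr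
      _ ≤ _ := by linarith
  calc _ ≤ (𝔼 i, r i) ^ (8 + K) * ((r i)⁻¹ ^ 7 * f i ^ (8 + K)) * (Fintype.card ι : ℝ)⁻¹ := by
        gcongr
    _ = _ := by ring

lemma pt_prod4 {A : Type} [Fintype A] (f : X → A → Y → Y → ℝ) :
    𝔼 x, 𝔼 y, 𝔼 u, 𝔼 v, f x y u v =
      𝔼 w : X × A × Y × Y, f w.1 w.2.1 w.2.2.1 w.2.2.2 := by
  rw [← pt_prod (fun x (w : A × Y × Y) => f x w.1 w.2.1 w.2.2)]
  refine Finset.expect_congr rfl fun x _ => ?_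
  rw [← pt_prod (fun x' (w : Y × Y) => f x x' w.1 w.2)]
  refine Finset.expect_congr rfl fun x _ => ?_
  rw [← pt_prod (fun u v => f _ _ u v)]

/-- the tensor-power of the integrand -/
noncomputable def ptR (n : ℕ) (g : X → (Fin n → Y) → Y → Y → ℝ) (p : Fin n → Bool → Y) : ℝ :=
  𝔼 u : Fin 4 → Y, 𝔼 v : Fin 4 → Y,
    |𝔼 x, ∏ l : Fin n → Bool, ∏ q : Fin 4, ∏ b : Bool,
      g x (fun j => p j (l j)) (u (q + if b then 1 else 0)) (v q)|

lemma pt_ind [Nonempty Y] (r : Y → Y → ℝ) (hr : ∀ a b, 1 ≤ r a b) (n : ℕ) :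
    ∀ (g : X → (Fin n → Y) → Y → Y → ℝ) (Z : Fin n → X → (Fin n → Y) → Y → Y → ℝ)
      (s t : X → (Fin n → Y) → Y → Y → ℝ)
      (_hZ : ∀ j x y u v, |Z j x y u v| ≤ 1) (_hs : ∀ x y u v, |s x y u v| ≤ 1)
      (_ht : ∀ x y u v, |t x y u v| ≤ 1)
      (_hZ' : ∀ j x y y' u v, (∀ j', j' ≠ j → y j' = y' j') → Z j x y u v = Z j x y' u v)
      (_hs' : ∀ x y u u' v, s x y u v = s x y u' v)
      (_ht' : ∀ x y u v v', t x y u v = t x y u v'),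
    (𝔼 x, 𝔼 y, 𝔼 u, 𝔼 v, g x y u v * (∏ j, Z j x y u v) * s x y u v * t x y u v) ^ (8 * 2 ^ n)
      ≤ (𝔼 a, 𝔼 b, r a b) ^ (8 * 2 ^ n) *
        𝔼 p : Fin n → Bool → Y, (∏ j, (r (p j false) (p j true))⁻¹ ^ 7) * ptR n g p := by
  have hV : 1 ≤ 𝔼 a, 𝔼 b, r a b := by
    calc (1:ℝ) = 𝔼 a : Y, 𝔼 b : Y, (1:ℝ) := by simp
      _ ≤ _ := Finset.expect_le_expect fun i _ => Finset.expect_le_expect fun j _ => hr i j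
  induction n with
  | zero =>
    intro g Z s t hZ hs ht hZ' hs' ht'
    obtain ⟨y0⟩ := (inferInstance : Nonempty Y)
    have e := pt_base (fun x u v => g x default u v) (fun x v => s x default y0 v)
      (fun x u => t x default u y0) (fun _ _ => hs _ _ _ _) (fun _ _ => ht _ _ _ _)
    have e0 : (1:ℝ) ≤ (𝔼 a, 𝔼 b, r a b) ^ (8 * 2 ^ 0) := one_le_pow₀ hV
    have e1 : (𝔼 p : Fin 0 → Bool → Y, (∏ j, (r (p j false) (p j true))⁻¹ ^ 7) * ptR 0 g p)
      = 𝔼 u : Fin 4 → Y, 𝔼 v : Fin 4 → Y,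
        |𝔼 x, ∏ q : Fin 4, ∏ b : Bool, g x default (u (q + if b then 1 else 0)) (v q)| := by
      rw [Finset.univ_unique, Finset.expect_singleton]
      simp [ptR, Subsingleton.elim _ (default : Fin 0 → Y)]
    have e2 : (𝔼 x, 𝔼 y, 𝔼 u, 𝔼 v, g x y u v * (∏ j, Z j x y u v) * s x y u v * t x y u v)
      = 𝔼 x, 𝔼 u, 𝔼 v, g x default u v * s x default y0 v * t x default u y0 := by
      refine Finset.expect_congr rfl fun x _ => ?_
      rw [Finset.univ_unique, Finset.expect_singleton]
      refine Finset.expect_congr rfl fun u _ => ?_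
      refine Finset.expect_congr rfl fun v _ => ?_
      rw [hs' x default u y0 v, ht' x default u v y0]
      simp
    rw [e1, e2]
    refine (le_trans (by simpa using e) (le_mul_of_one_le_left ?_ e0))
    exact Finset.expect_nonneg fun _ _ => Finset.expect_nonneg fun _ _ => abs_nonneg _
  | succ n ih =>
    intro g Z s t hZ hs ht hZ' hs' ht'
    obtain ⟨y0⟩ := (inferInstance : Nonempty Y)
    set I := (𝔼 x, 𝔼 y, 𝔼 u, 𝔼 v, g x y u v * (∏ j, Z j x y u v) * s x y u v * t x y u v) with hI
    let G : X → (Fin n → Y) → Y → Y → Y → ℝ := fun x y u v a =>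
      g x (Fin.cons a y) u v * (∏ j : Fin n, Z j.succ x (Fin.cons a y) u v) *
        s x (Fin.cons a y) u v * t x (Fin.cons a y) u v
    let XX : Y × Y → ℝ := fun a => 𝔼 x, 𝔼 y, 𝔼 u, 𝔼 v, G x y u v a.1 * G x y u v a.2
    have e1 : I = 𝔼 w : X × (Fin n → Y) × Y × Y,
        Z 0 w.1 (Fin.cons y0 w.2.1) w.2.2.1 w.2.2.2 *
          𝔼 a, G w.1 w.2.1 w.2.2.1 w.2.2.2 a := by
      simp_rw [hI, pt_cons, Finset.mul_expect]
      rw [← pt_prod4 (fun x (y : Fin n → Y) u v => 𝔼 a, Z 0 x (Fin.cons y0 y) u v * G x y u v a)]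
      refine Finset.expect_congr rfl fun x _ => ?_
      rw [Finset.expect_comm]
      refine Finset.expect_congr rfl fun y _ => ?_
      rw [Finset.expect_comm]
      refine Finset.expect_congr rfl fun u _ => ?_
      rw [Finset.expect_comm]
      refine Finset.expect_congr rfl fun v _ => ?_
      refine Finset.expect_congr rfl fun a _ => ?_
      simp only [G]
      rw [Fin.prod_univ_succ, hZ' 0 x (Fin.cons a y) (Fin.cons y0 y)]
      · ring
      · intro j hj
        obtain ⟨i, rfl⟩ := Fin.exists_succ_eq.2 hj
        simp
    have e2 : I ^ 2 ≤ 𝔼 a, XX a := by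
      rw [e1]
      refine (pt_cs _ _ (fun w => hZ _ _ _ _ _)).trans (le_of_eq ?_)
      simp_rw [pt_sq]
      rw [Finset.expect_comm, ← pt_prod (fun a a' => XX (a, a'))]
      refine Finset.expect_congr rfl fun a _ => ?_
      rw [Finset.expect_comm]
      refine Finset.expect_congr rfl fun a' _ => ?_
      simp only [XX]
      rw [pt_prod4]
    have hN : 8 ≤ 8 * 2 ^ n := Nat.le_mul_of_pos_right _ (by positivity)
    have hev : Even (8 * 2 ^ n) := ⟨4 * 2 ^ n, by ring⟩
    have e3 : I ^ (8 * 2 ^ (n + 1)) ≤ (𝔼 a, XX a) ^ (8 * 2 ^ n) := by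
      rw [show 8 * 2 ^ (n + 1) = 2 * (8 * 2 ^ n) by ring, pow_mul]
      exact pow_le_pow_left₀ (sq_nonneg _) e2 _
    have e4 := pt_jensen (fun a : Y × Y => r a.1 a.2) XX (fun _ => hr _ _) (8 * 2 ^ n) hN hev
    rw [← pt_prod] at e4
    set V := 𝔼 a, 𝔼 b, r a b with hVdef
    have e5 : ∀ a : Y × Y, XX a ^ (8 * 2 ^ n) ≤ V ^ (8 * 2 ^ n) *
        𝔼 p : Fin n → Bool → Y, (∏ j, (r (p j false) (p j true))⁻¹ ^ 7) *
          ptR n (fun x y u v => g x (Fin.cons a.1 y) u v * g x (Fin.cons a.2 y) u v) p := by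
      intro a
      have := ih (fun x y u v => g x (Fin.cons a.1 y) u v * g x (Fin.cons a.2 y) u v)
        (fun j x y u v => Z j.succ x (Fin.cons a.1 y) u v * Z j.succ x (Fin.cons a.2 y) u v)
        (fun x y u v => s x (Fin.cons a.1 y) u v * s x (Fin.cons a.2 y) u v)
        (fun x y u v => t x (Fin.cons a.1 y) u v * t x (Fin.cons a.2 y) u v)
        (fun j x y u v => by
          rw [abs_mul]; exact mul_le_one₀ (hZ _ _ _ _ _) (abs_nonneg _) (hZ _ _ _ _ _))
        (fun x y u v => by
          rw [abs_mul]; exact mul_le_one₀ (hs _ _ _ _) (abs_nonneg _) (hs _ _ _ _))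
        (fun x y u v => by
          rw [abs_mul]; exact mul_le_one₀ (ht _ _ _ _) (abs_nonneg _) (ht _ _ _ _))
        (fun j x y y' u v h => by
          have : ∀ c : Y, ∀ j', j' ≠ j.succ →
              (Fin.cons c y : Fin (n + 1) → Y) j' = (Fin.cons c y' : Fin (n + 1) → Y) j' := by
            intro c j' hj'
            refine Fin.cases (by simp) (fun i hi => ?_) j' hj'
            simpa using h i (fun hh => hi (by rw [hh]))
          rw [hZ' j.succ x _ _ u v (this a.1), hZ' j.succ x _ _ u v (this a.2)])
        (fun x y u u' v => by rw [hs' x _ u u' v, hs' x _ u u' v])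
        (fun x y u v v' => by rw [ht' x _ u v v', ht' x _ u v v'])
      refine le_trans (le_of_eq ?_) this
      congr 1
      refine Finset.expect_congr rfl fun x _ => ?_
      refine Finset.expect_congr rfl fun y _ => ?_
      refine Finset.expect_congr rfl fun u _ => ?_
      refine Finset.expect_congr rfl fun v _ => ?_
      simp only [G]
      rw [Finset.prod_mul_distrib]
      ring
    refine e3.trans (e4.trans ?_)
    rw [show 8 * 2 ^ (n + 1) = (8 * 2 ^ n) + (8 * 2 ^ n) by ring, pow_add, mul_assoc]
    refine mul_le_mul_of_nonneg_left ?_ (by positivity)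
    rw [Finset.mul_expect, pt_cons, pt_bool, ← pt_prod (fun a a' => (r a a')⁻¹ ^ 7 * XX (a, a') ^ (8 * 2 ^ n))]
    refine Finset.expect_le_expect fun a _ => ?_
    refine Finset.expect_le_expect fun a' _ => ?_
    have hpos : 0 ≤ (r a a')⁻¹ ^ 7 := by
      have := hr a a'
      positivity
    refine (mul_le_mul_of_nonneg_left (e5 (a, a')) hpos).trans (le_of_eq ?_)
    rw [Finset.mul_expect, Finset.mul_expect]
    refine Finset.expect_congr rfl fun p _ => ?_
    rw [Fin.prod_univ_succ]
    have e6 : ptR n (fun x y u v => g x (Fin.cons a y) u v * g x (Fin.cons a' y) u v) p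
      = ptR (n + 1) g (Fin.cons (fun b => if b then a' else a) p) := by
      unfold ptR
      refine Finset.expect_congr rfl fun u _ => ?_
      refine Finset.expect_congr rfl fun v _ => ?_
      congr 1
      refine Finset.expect_congr rfl fun x _ => ?_
      rw [pt_prodcons]
      refine Finset.prod_congr rfl fun l _ => ?_
      simp only [Finset.prod_mul_distrib, Fintype.prod_bool]
      have : ∀ b : Bool, (fun j => (Fin.cons (fun b => if b then a' else a) p : Fin (n+1) → Bool → Y) j
          ((Fin.cons b l : Fin (n+1) → Bool) j)) = Fin.cons (if b then a' else a) (fun j => p j (l j)) := by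
        intro b
        funext j
        refine Fin.cases (by simp) (fun i => by simp) j
      rw [this, this]
      simp only [if_true, Bool.false_eq_true, if_false]
      ring
    simp only [Fin.cons_zero, Fin.cons_succ, e6]
    simp
    ring
end analytic


section core
variable {m : ℕ}

lemma pt_vanish_aux (d : ℕ) (φ : (Fin m → Bool) → ℝ)
    (hφ2 : ∀ T : Finset (Fin m), T.card ≤ d →
      ∑ z, φ z * ∏ i ∈ T, (if z i then 1 else -1 : ℝ) = 0)
    (B : Finset (Fin m)) (hB : B.card ≤ d) (z0 : Fin m → Bool) :
    ∑ z, φ z * (if ∀ i ∈ B, z i = z0 i then 1 else 0 : ℝ) = 0 := by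
  have h1 : ∀ z : Fin m → Bool, (if ∀ i ∈ B, z i = z0 i then 1 else 0 : ℝ) =
      ∏ i ∈ B, ((1 / 2 : ℝ) * (if z0 i then 1 else -1) * (if z i then 1 else -1) + 1 / 2) := by
    intro z
    split_ifs with h
    · symm
      apply Finset.prod_eq_one
      intro i hi
      rw [h i hi]
      split_ifs <;> norm_num
    · push Not at h
      obtain ⟨i, hi, hne⟩ := h
      symm
      apply Finset.prod_eq_zero hi
      cases h1 : z i <;> cases h2 : z0 i <;> simp_all
  simp_rw [h1, Finset.prod_add, Finset.mul_sum]
  rw [Finset.sum_comm]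
  apply Finset.sum_eq_zero
  intro T hT
  rw [Finset.mem_powerset] at hT
  have := hφ2 T ((Finset.card_le_card hT).trans hB)
  simp_rw [Finset.prod_mul_distrib]
  calc _ = (∑ z, φ z * ∏ i ∈ T, (if z i then 1 else -1 : ℝ)) *
      ((∏ i ∈ T, (1/2 : ℝ)) * (∏ i ∈ T, (if z0 i then 1 else -1 : ℝ)) * ∏ i ∈ B \ T, (1/2 : ℝ)) := by
        rw [Finset.sum_mul]
        refine Finset.sum_congr rfl fun z _ => ?_
        ring
    _ = 0 := by rw [this, zero_mul]

lemma pt_vanish (d : ℕ) (φ : (Fin m → Bool) → ℝ)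
    (hφ2 : ∀ T : Finset (Fin m), T.card ≤ d →
      ∑ z, φ z * ∏ i ∈ T, (if z i then 1 else -1 : ℝ) = 0)
    (B : Finset (Fin m)) (hB : B.card ≤ d) (z0 : Fin m → Bool) :
    ∑ w : Fin m → Bool, φ (fun i => if i ∈ B then z0 i else w i) = 0 := by
  have h0 := pt_vanish_aux d φ hφ2 B hB z0
  let σ : ((Fin m → Bool) × (Fin m → Bool)) → ((Fin m → Bool) × (Fin m → Bool)) := fun p =>
    (fun i => if i ∈ B then p.2 i else p.1 i, fun i => if i ∈ B then p.1 i else p.2 i)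
  have hσ : Function.Involutive σ := by
    rintro ⟨a, b⟩
    simp only [σ, Prod.mk.injEq]
    constructor <;> funext i <;> split_ifs <;> rfl
  have h1 : ∑ p : (Fin m → Bool) × (Fin m → Bool), φ p.2 * (if ∀ i ∈ B, p.2 i = z0 i then 1 else 0 : ℝ) = 0 := by
    rw [Fintype.sum_prod_type]
    simp only [h0, Finset.sum_const_zero]
  rw [← Equiv.sum_comp (Function.Involutive.toPerm σ hσ)] at h1
  rw [Fintype.sum_prod_type] at h1
  have h2 : ∀ u w : Fin m → Bool, φ (Function.Involutive.toPerm σ hσ (u, w)).2 * (if ∀ i ∈ B, (Function.Involutive.toPerm σ hσ (u, w)).2 i = z0 i then 1 else 0 : ℝ)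
      = (if ∀ i ∈ B, u i = z0 i then 1 else 0 : ℝ) * φ (fun i => if i ∈ B then z0 i else w i) := by
    intro u w
    simp only [Function.Involutive.coe_toPerm, σ]
    have : (∀ i ∈ B, (if i ∈ B then u i else w i) = z0 i) ↔ ∀ i ∈ B, u i = z0 i := by
      refine forall₂_congr fun i hi => ?_
      rw [if_pos hi]
    simp only [this]
    split_ifs with h
    · rw [mul_one, one_mul]
      congr 1
      funext i
      split_ifs with hi
      · exact h i hi
      · rfl
    · simp
  simp_rw [h2] at h1
  simp_rw [← Finset.mul_sum] at h1
  rw [← Finset.sum_mul] at h1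
  rcases mul_eq_zero.1 h1 with h | h
  · exfalso
    have : (0:ℝ) < ∑ u : Fin m → Bool, (if ∀ i ∈ B, u i = z0 i then 1 else 0 : ℝ) := by
      apply Finset.sum_pos'
      · intros; split_ifs <;> norm_num
      · exact ⟨z0, Finset.mem_univ _, by simp⟩
    linarith
  · exact h

lemma pt_vanish_xor (d : ℕ) (φ : (Fin m → Bool) → ℝ)
    (hφ2 : ∀ T : Finset (Fin m), T.card ≤ d →
      ∑ z, φ z * ∏ i ∈ T, (if z i then 1 else -1 : ℝ) = 0)
    (B : Finset (Fin m)) (hB : B.card ≤ d) (z : Fin m → Bool) :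
    ∑ w : Fin m → Bool, φ (fun i => if i ∈ B then z i else xor (z i) (w i)) = 0 := by
  rw [← pt_vanish d φ hφ2 B hB z]
  have hσ : Function.Involutive (fun (w : Fin m → Bool) i => xor (z i) (w i)) := by
    intro w; funext i; simp
  exact Equiv.sum_comp hσ.toPerm (fun w => φ (fun i => if i ∈ B then z i else w i))

variable {E C : Type} [Fintype E] [DecidableEq E] [Fintype C] [DecidableEq C]

def ptT (cell : E → C) : Finset E := univ.filter (fun e => ∃ e', e' ≠ e ∧ cell e' = cell e)

lemma pt_core_zero (d : ℕ) (φ : (Fin m → Bool) → ℝ)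
    (hφ2 : ∀ T : Finset (Fin m), T.card ≤ d →
      ∑ z, φ z * ∏ i ∈ T, (if z i then 1 else -1 : ℝ) = 0)
    (cell : Fin m → E → C) (e0 : E)
    (h : (univ.filter (fun i => e0 ∈ ptT (cell i))).card ≤ d) :
    ∑ x : Fin m → C → Bool, ∏ e, φ (fun i => x i (cell i e)) = 0 := by
  set B := univ.filter (fun i => e0 ∈ ptT (cell i)) with hBdef
  let τ : (Fin m → Bool) → (Fin m → C → Bool) → (Fin m → C → Bool) := fun w x i c =>
    if i ∉ B ∧ c = cell i e0 then xor (x i c) (w i) else x i c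
  have hτ : ∀ w, Function.Involutive (τ w) := by
    intro w x
    funext i c
    simp only [τ]
    split_ifs <;> simp
  have h1 : ∀ w, ∑ x : Fin m → C → Bool, ∏ e, φ (fun i => x i (cell i e)) =
      ∑ x : Fin m → C → Bool, ∏ e, φ (fun i => τ w x i (cell i e)) := fun w =>
    (Equiv.sum_comp (hτ w).toPerm (fun x => ∏ e, φ (fun i => x i (cell i e)))).symm
  have h2 : ∑ w : Fin m → Bool, ∑ x : Fin m → C → Bool, ∏ e, φ (fun i => τ w x i (cell i e)) = 0 := by
    rw [Finset.sum_comm]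
    apply Finset.sum_eq_zero
    intro x _
    have h3 : ∀ w, ∏ e, φ (fun i => τ w x i (cell i e)) =
        φ (fun i => if i ∈ B then x i (cell i e0) else xor (x i (cell i e0)) (w i)) *
          ∏ e ∈ univ.erase e0, φ (fun i => x i (cell i e)) := by
      intro w
      rw [← Finset.mul_prod_erase univ _ (Finset.mem_univ e0)]
      congr 1
      · congr 1
        funext i
        simp only [τ]
        by_cases hi : i ∈ B <;> simp [hi]
      · refine Finset.prod_congr rfl fun e he => ?_
        congr 1
        funext i
        simp only [τ]
        rw [if_neg]
        rintro ⟨hi, hc⟩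
        apply hi
        simp only [hBdef, ptT, Finset.mem_filter, Finset.mem_univ, true_and]
        exact ⟨e, (Finset.mem_erase.1 he).1, hc⟩
    simp_rw [h3]
    rw [← Finset.sum_mul, pt_vanish_xor d φ hφ2 B h (fun i => x i (cell i e0)), zero_mul]
  simp_rw [← h1] at h2
  rw [Finset.sum_const] at h2
  simpa using h2

lemma pt_cellprob (cell : E → C) (w : E → Bool) :
    𝔼 x : C → Bool, (if ∀ e, x (cell e) = w e then 1 else 0 : ℝ) ≤
      ((2:ℝ) ^ (univ.image cell).card)⁻¹ := by
  classical
  let h : C → Bool → ℝ := fun c b => if hc : ∃ e, cell e = c then (if b = w hc.choose then 1 else 0) else 1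
  have h1 : ∀ x : C → Bool, (if ∀ e, x (cell e) = w e then 1 else 0 : ℝ) ≤ ∏ c, h c (x c) := by
    intro x
    split_ifs with hx
    · apply le_of_eq
      symm
      apply Finset.prod_eq_one
      intro c _
      simp only [h]
      split_ifs with hc hb
      · rfl
      · exfalso; apply hb
        have := hx hc.choose
        rw [hc.choose_spec] at this
        exact this
      · rfl
    · apply Finset.prod_nonneg
      intro c _
      simp only [h]
      split_ifs <;> norm_num
  refine (Finset.expect_le_expect fun x _ => h1 x).trans (le_of_eq ?_)
  rw [pt_pi]
  have h2 : ∀ c, 𝔼 b, h c b = if c ∈ univ.image cell then (2:ℝ)⁻¹ else 1 := by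
    intro c
    rw [Fintype.expect_eq_sum_div_card]
    by_cases hc : ∃ e, cell e = c
    · have : c ∈ univ.image cell := by simpa using hc
      rw [if_pos this]
      simp only [h, dif_pos hc]
      cases w hc.choose <;> simp
    · have : c ∉ univ.image cell := by simpa using hc
      rw [if_neg this]
      simp [h, dif_neg hc]
  simp_rw [h2]
  rw [Finset.prod_ite_mem, Finset.univ_inter, Finset.prod_const, inv_pow]

lemma pt_core_bound (φ : (Fin m → Bool) → ℝ) (hφ1 : (∑ z, |φ z|) = 1)
    (cell : Fin m → E → C) :
    |𝔼 x : Fin m → C → Bool, ∏ e, (2 ^ m * φ (fun i => x i (cell i e)))| ≤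
      ∏ i, (2:ℝ) ^ (Fintype.card E - (univ.image (cell i)).card) := by
  have h1 : ∀ x : Fin m → C → Bool, |∏ e, (2 ^ m * φ (fun i => x i (cell i e)))| =
      ∑ w : E → Fin m → Bool, (∏ e, (2 ^ m * |φ (w e)|)) *
        ∏ i, (if ∀ e, x i (cell i e) = w e i then 1 else 0 : ℝ) := by
    intro x
    rw [Finset.sum_eq_single (fun e i => x i (cell i e))]
    · simp [Finset.abs_prod, abs_mul]
    · intro w _ hw
      have : ∃ i, ¬ ∀ e, x i (cell i e) = w e i := by
        by_contra hcon
        push Not at hcon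
        apply hw
        funext e i
        exact (hcon i e).symm
      obtain ⟨i, hi⟩ := this
      rw [Finset.prod_eq_zero (Finset.mem_univ i) (if_neg hi), mul_zero]
    · simp
  calc _ ≤ 𝔼 x : Fin m → C → Bool, |∏ e, (2 ^ m * φ (fun i => x i (cell i e)))| :=
        Finset.abs_expect_le _ _
    _ = ∑ w : E → Fin m → Bool, (∏ e, (2 ^ m * |φ (w e)|)) *
        ∏ i, 𝔼 x : C → Bool, (if ∀ e, x (cell i e) = w e i then 1 else 0 : ℝ) := by
        simp_rw [h1]
        rw [Finset.expect_sum_comm]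
        refine Finset.sum_congr rfl fun w _ => ?_
        rw [← Finset.mul_expect,
          pt_pi (fun i (x : C → Bool) => (if ∀ e, x (cell i e) = w e i then 1 else 0 : ℝ))]
    _ ≤ ∑ w : E → Fin m → Bool, (∏ e, (2 ^ m * |φ (w e)|)) *
        ∏ i, ((2:ℝ) ^ (univ.image (cell i)).card)⁻¹ := by
        refine Finset.sum_le_sum fun w _ => ?_
        refine mul_le_mul_of_nonneg_left ?_ (Finset.prod_nonneg fun e _ => by positivity)
        refine Finset.prod_le_prod (fun i _ => ?_) (fun i _ => pt_cellprob _ _)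
        exact Finset.expect_nonneg fun x _ => by split_ifs <;> norm_num
    _ = ((2:ℝ) ^ m) ^ Fintype.card E * ∏ i, ((2:ℝ) ^ (univ.image (cell i)).card)⁻¹ := by
        rw [← Finset.sum_mul]
        congr 1
        have := Finset.prod_univ_sum (fun _ : E => (univ : Finset (Fin m → Bool))) (fun _ w => 2 ^ m * |φ w|)
        rw [Fintype.piFinset_univ] at this
        rw [← this]
        simp [← Finset.mul_sum, hφ1]
    _ = _ := by
        have : ((2:ℝ) ^ m) ^ Fintype.card E = ∏ i : Fin m, (2:ℝ) ^ Fintype.card E := by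
          simp [← pow_mul, mul_comm]
        rw [this, ← Finset.prod_mul_distrib]
        refine Finset.prod_congr rfl fun i _ => ?_
        have hle : (univ.image (cell i)).card ≤ Fintype.card E := Finset.card_image_le
        rw [pow_sub₀ _ (by norm_num) hle]

lemma pt_core (d : ℕ) (φ : (Fin m → Bool) → ℝ) (hφ1 : (∑ z, |φ z|) = 1)
    (hφ2 : ∀ T : Finset (Fin m), T.card ≤ d →
      ∑ z, φ z * ∏ i ∈ T, (if z i then 1 else -1 : ℝ) = 0)
    (cell : Fin m → E → C) (lam : ℝ) (hlam : 1 ≤ lam) :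
    |𝔼 x : Fin m → C → Bool, ∏ e, (2 ^ m * φ (fun i => x i (cell i e)))| ≤
      (∏ i, (2:ℝ) ^ (Fintype.card E - (univ.image (cell i)).card) * lam ^ (ptT (cell i)).card) *
        (lam ^ (Fintype.card E * (d + 1)))⁻¹ := by
  have hl0 : 0 < lam := by linarith
  by_cases h : ∃ e0, (univ.filter (fun i => e0 ∈ ptT (cell i))).card ≤ d
  · obtain ⟨e0, h⟩ := h
    have := pt_core_zero d φ hφ2 cell e0 h
    have h0 : 𝔼 x : Fin m → C → Bool, ∏ e, (2 ^ m * φ (fun i => x i (cell i e))) = 0 := by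
      simp_rw [Finset.prod_mul_distrib, ← Finset.mul_expect]
      rw [Fintype.expect_eq_sum_div_card, this]
      simp
    rw [h0, abs_zero]
    positivity
  · push Not at h
    refine (pt_core_bound φ hφ1 cell).trans ?_
    rw [Finset.prod_mul_distrib, mul_assoc]
    refine le_mul_of_one_le_right (by positivity) ?_
    rw [← div_eq_mul_inv, one_le_div (by positivity), Finset.prod_pow_eq_pow_sum]
    apply pow_le_pow_right₀ hlam
    have h3 : ∑ i, (ptT (cell i)).card = ∑ e : E, (univ.filter (fun i => e ∈ ptT (cell i))).card := by
      simp_rw [Finset.card_eq_sum_ones, Finset.sum_filter]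
      rw [Finset.sum_comm]
      refine Finset.sum_congr rfl fun i _ => ?_
      simp
    rw [h3]
    calc Fintype.card E * (d + 1) = ∑ e : E, (d + 1) := by simp
      _ ≤ _ := Finset.sum_le_sum fun e _ => h e
end core


def ptCell8 {α β : Type} (u : Fin 4 → α) (v : Fin 4 → β) : Fin 4 × Bool → α × β :=
  fun e => (u (e.1 + if e.2 then 1 else 0), v e.1)

def ptC8 {α β : Type} [DecidableEq α] [DecidableEq β] (u : Fin 4 → α) (v : Fin 4 → β) : ℕ :=
  (univ.image (ptCell8 u v)).card

def ptT8 {α β : Type} [DecidableEq α] [DecidableEq β] (u : Fin 4 → α) (v : Fin 4 → β) : ℕ :=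
  (ptT (ptCell8 u v)).card


/-- number of occurrences -/
def ptCnt (x : ℕ) : List ℕ → ℕ
  | [] => 0
  | y :: l => bif Nat.beq x y then ptCnt x l + 1 else ptCnt x l

/-- number of distinct entries -/
def ptDist : List ℕ → ℕ
  | [] => 0
  | y :: l => bif Nat.beq (ptCnt y l) 0 then ptDist l + 1 else ptDist l

/-- number of entries of l that occur at least twice in l0 -/
def ptDup (l0 : List ℕ) : List ℕ → ℕ
  | [] => 0
  | y :: l => bif Nat.ble 2 (ptCnt y l0) then ptDup l0 l + 1 else ptDup l0 l

def ptCode : List ℕ → List ℕ → List ℕ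
  | [a, b, c, d], [x, y, z, t] =>
    [4 * a + x, 4 * b + x, 4 * b + y, 4 * c + y, 4 * c + z, 4 * d + z, 4 * d + t, 4 * a + t]
  | _, _ => []

def ptCanL : List (List ℕ) :=
  [[0,0,0,0], [0,0,0,3], [0,0,2,0], [0,0,2,2], [0,0,2,3],
   [0,1,0,0], [0,1,0,1], [0,1,0,3], [0,1,1,0], [0,1,1,1], [0,1,1,3],
   [0,1,2,0], [0,1,2,1], [0,1,2,2], [0,1,2,3]]

/-- weight, as a function of the three statistics -/
def ptWt (t r e : ℕ) : ℕ :=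
  bif Nat.beq t 0 then 0 else
  bif Nat.beq r 1 && (Nat.ble t 2 && Nat.ble e 3) then 78125 else
  bif Nat.beq r 2 && (Nat.ble t 4 && Nat.ble e 6) then 6104 else
  bif Nat.beq r 3 && (Nat.ble t 8 && Nat.ble e 12) then 5961 else
  bif Nat.beq r 4 && (Nat.ble t 8 && Nat.ble e 16) then 597 else
  bif Nat.beq r 5 && (Nat.ble t 8 && Nat.ble e 20) then 60 else
  bif Nat.beq r 6 && (Nat.ble t 8 && Nat.ble e 24) then 6 else 1000000000

def ptW (l l' : List ℕ) : ℕ :=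
  ptWt (ptDup (ptCode l l') (ptCode l l')) ((4 - ptDist l) + (4 - ptDist l'))
    (8 - ptDist (ptCode l l') + ptDup (ptCode l l') (ptCode l l'))

def ptToL (p : Fin 4 → Fin 4) : List ℕ := [(p 0).val, (p 1).val, (p 2).val, (p 3).val]

lemma ptCan_mem : ∀ p : Fin 4 → Fin 4, (∀ i, p (p i) = p i) → (∀ i, p i ≤ i) → ptToL p ∈ ptCanL := by
  decide +kernel

lemma ptW_sum : Nat.ble (ptCanL.map (fun l => (ptCanL.map (fun l' => ptW l l')).sum)).sum 1467901 = true := by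
  decide +kernel

lemma ptCnt_eq (x : ℕ) (l : List ℕ) : ptCnt x l = l.count x := by
  induction l with
  | nil => rfl
  | cons y l ih =>
    rw [ptCnt, List.count_cons, ih]
    by_cases h : x = y
    · subst h; simp
    · have h' : Nat.beq x y = false := by
        rw [← Bool.not_eq_true, Nat.beq_eq]; exact h
      rw [h', if_neg (by simpa using fun h'' => h h''.symm)]
      rfl

lemma ptDist_eq (l : List ℕ) : ptDist l = l.toFinset.card := by
  induction l with
  | nil => rfl
  | cons y l ih =>
    rw [ptDist, List.toFinset_cons, ih, ptCnt_eq]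
    by_cases h : y ∈ l
    · have : Nat.beq (l.count y) 0 = false := by
        rw [← Bool.not_eq_true, Nat.beq_eq]; simpa [List.count_eq_zero] using h
      rw [this, Finset.insert_eq_of_mem (by simpa using h)]
      rfl
    · have : Nat.beq (l.count y) 0 = true := by
        rw [Nat.beq_eq]; simpa [List.count_eq_zero] using h
      rw [this, Finset.card_insert_of_notMem (by simpa using h)]
      rfl

lemma ptDup_eq (l0 : List ℕ) (l : List ℕ) :
    ptDup l0 l = l.countP (fun y => decide (2 ≤ l0.count y)) := by
  induction l with
  | nil => rfl
  | cons y l ih =>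
    rw [ptDup, List.countP_cons, ih, ptCnt_eq]
    by_cases h : 2 ≤ l0.count y
    · rw [show Nat.ble 2 (l0.count y) = true by rw [Nat.ble_eq]; exact h]
      simp [h]
    · rw [show Nat.ble 2 (l0.count y) = false by rw [← Bool.not_eq_true, Nat.ble_eq]; exact h]
      simp [h]

def ptLE : List (Fin 4 × Bool) :=
  [(0, false), (0, true), (1, false), (1, true), (2, false), (2, true), (3, false), (3, true)]

lemma ptLE_nodup : ptLE.Nodup := by decide

lemma ptLE_univ : (univ : Finset (Fin 4 × Bool)) = ptLE.toFinset := by decide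

def ptKap (z : Fin 4 × Fin 4) : ℕ := 4 * z.1.val + z.2.val

lemma ptKap_inj : Function.Injective ptKap := by
  rintro ⟨a, b⟩ ⟨c, d⟩ h
  simp only [ptKap] at h
  ext <;> simp <;> omega

lemma ptCode_eq (p q : Fin 4 → Fin 4) :
    ptCode (ptToL p) (ptToL q) = ptLE.map (fun e => ptKap (ptCell8 p q e)) := rfl

lemma ptC8_eq (p q : Fin 4 → Fin 4) : ptDist (ptCode (ptToL p) (ptToL q)) = ptC8 p q := by
  rw [ptDist_eq, ptCode_eq, ptC8, ptLE_univ]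
  rw [← Finset.card_image_of_injective _ ptKap_inj, Finset.image_image]
  congr 1

lemma ptT8_eq (p q : Fin 4 → Fin 4) :
    ptDup (ptCode (ptToL p) (ptToL q)) (ptCode (ptToL p) (ptToL q)) = ptT8 p q := by
  rw [ptDup_eq, ptCode_eq, ptT8, ptT, List.countP_map]
  set f := fun e => ptKap (ptCell8 p q e) with hf
  have h1 : ∀ e, (ptLE.map f).count (f e) = (univ.filter (fun e' => f e' = f e)).card := by
    intro e
    rw [List.count, List.countP_map, ptLE_univ, List.countP_eq_length_filter]
    rw [← List.toFinset_card_of_nodup (ptLE_nodup.filter _)]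
    congr 1
    ext e'
    simp
  have h2 : ∀ e, 2 ≤ (ptLE.map f).count (f e) ↔ ∃ e', e' ≠ e ∧ ptCell8 p q e' = ptCell8 p q e := by
    intro e
    rw [h1]
    constructor
    · intro h
      obtain ⟨b, hb, hne⟩ := Finset.exists_mem_ne h e
      exact ⟨b, hne, ptKap_inj (Finset.mem_filter.1 hb).2⟩
    · rintro ⟨b, hne, hb⟩
      refine Finset.one_lt_card.2 ⟨b, ?_, e, ?_, hne⟩ <;> simp [hf, hb]
  rw [List.countP_eq_length_filter, ← List.toFinset_card_of_nodup (ptLE_nodup.filter _)]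
  congr 1
  ext e
  have : e ∈ ptLE := by
    have := Finset.mem_univ e
    rw [ptLE_univ] at this
    simpa using this
  simp [this, h2]

lemma ptIm_eq (p : Fin 4 → Fin 4) : ptDist (ptToL p) = (univ.image p).card := by
  rw [ptDist_eq, ← Finset.card_image_of_injective _ Fin.val_injective, Finset.image_image]
  congr 1

lemma ptToL_inj : Function.Injective ptToL := by
  intro p q h
  simp only [ptToL, List.cons.injEq, and_true] at h
  obtain ⟨h0, h1, h2, h3⟩ := h
  funext i
  fin_cases i <;> apply Fin.ext <;> assumption

/-- canonical form -/
def ptcan {α : Type} [DecidableEq α] (u : Fin 4 → α) : Fin 4 → Fin 4 := fun i =>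
  (univ.filter (fun j => u j = u i)).min' ⟨i, by simp⟩

section can
variable {α : Type} [DecidableEq α] (u : Fin 4 → α)

lemma ptcan_apply (i : Fin 4) : u (ptcan u i) = u i := by
  have := Finset.min'_mem (univ.filter (fun j => u j = u i)) ⟨i, by simp⟩
  exact (Finset.mem_filter.1 this).2

lemma ptcan_le (i : Fin 4) : ptcan u i ≤ i :=
  Finset.min'_le _ _ (by simp)

lemma ptcan_eq (i j : Fin 4) : ptcan u i = ptcan u j ↔ u i = u j := by
  constructor
  · intro h
    rw [← ptcan_apply u i, h, ptcan_apply u j]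
  · intro h
    simp only [ptcan, h]

lemma ptcan_mem : ptToL (ptcan u) ∈ ptCanL :=
  ptCan_mem _ (fun i => (ptcan_eq u _ _).2 (ptcan_apply u i)) (ptcan_le u)
end can

lemma pt_image_le {E C C' : Type} [Fintype E] [DecidableEq C] [DecidableEq C'] (f : E → C) (g : E → C')
    (h : ∀ e e', g e = g e' → f e = f e') : (univ.image f).card ≤ (univ.image g).card := by
  classical
  rcases isEmpty_or_nonempty E with hE | hE
  · simp
  have : f = (fun c => f (Function.invFun g c)) ∘ g := by
    funext e
    exact (h _ _ (Function.invFun_eq ⟨e, rfl⟩)).symm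
  rw [this, ← Finset.image_image]
  exact Finset.card_image_le

lemma ptCell8_can {α β : Type} [DecidableEq α] [DecidableEq β] (u : Fin 4 → α) (v : Fin 4 → β) (e e') :
    ptCell8 (ptcan u) (ptcan v) e = ptCell8 (ptcan u) (ptcan v) e' ↔ ptCell8 u v e = ptCell8 u v e' := by
  simp only [ptCell8, Prod.mk.injEq, ptcan_eq]

lemma ptC8_can {α β : Type} [DecidableEq α] [DecidableEq β] (u : Fin 4 → α) (v : Fin 4 → β) :
    ptC8 u v = ptC8 (ptcan u) (ptcan v) :=
  le_antisymm (pt_image_le _ _ fun e e' => (ptCell8_can u v e e').1)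
    (pt_image_le _ _ fun e e' => (ptCell8_can u v e e').2)

lemma ptT8_can {α β : Type} [DecidableEq α] [DecidableEq β] (u : Fin 4 → α) (v : Fin 4 → β) :
    ptT8 u v = ptT8 (ptcan u) (ptcan v) := by
  simp only [ptT8, ptT, ptCell8_can]

lemma pt_prob {M : ℕ} (hM : 0 < M) (p : Fin 4 → Fin 4) :
    𝔼 u : Fin 4 → Fin M, (if ptcan u = p then 1 else 0 : ℝ) ≤ ((M:ℝ) ^ (4 - (univ.image p).card))⁻¹ := by
  classical
  have h1 : (univ.filter (fun u : Fin 4 → Fin M => ptcan u = p)).card ≤ M ^ (univ.image p).card := by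
    have := Finset.card_le_card_of_injOn (s := univ.filter (fun u : Fin 4 → Fin M => ptcan u = p))
      (t := (univ : Finset ({x // x ∈ univ.image p} → Fin M))) (fun u i => u i.1)
      (fun _ _ => Finset.mem_coe.2 (Finset.mem_univ _)) (by
        intro u hu u' hu' h
        have hu := (Finset.mem_filter.1 (Finset.mem_coe.1 hu)).2
        have hu' := (Finset.mem_filter.1 (Finset.mem_coe.1 hu')).2
        funext i
        rw [← ptcan_apply u i, ← ptcan_apply u' i, hu, hu']
        exact congrFun h ⟨p i, by simp⟩)
    rw [Finset.card_univ, Fintype.card_fun, Fintype.card_fin, Fintype.card_coe] at this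
    exact this
  have hle : (univ.image p).card ≤ 4 := by
    simpa using Finset.card_image_le (s := univ) (f := p)
  have hM' : (0:ℝ) < M := by exact_mod_cast hM
  rw [Fintype.expect_eq_sum_div_card, Finset.sum_boole]
  simp only [Fintype.card_pi, Finset.prod_const, Finset.card_univ, Fintype.card_fin]
  rw [div_le_iff₀ (by positivity)]
  calc _ ≤ (M:ℝ) ^ (univ.image p).card := by exact_mod_cast h1
    _ = _ := by
      rw [pow_sub₀ _ hM'.ne' hle]
      push_cast
      field_simp

lemma pt_term (A M : ℝ) (hA : 2 ≤ A) (hM : 0 < M) (t t0 r e s : ℕ) (ht : t ≤ t0) (he : e + s ≤ 4 * r)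
    (hr : 1 ≤ r) (hd : A ^ 4 / M ≤ 1 / 10) :
    A ^ e * (5/4) ^ t * (M ^ r)⁻¹ ≤ (5/4) ^ t0 * (1/2) ^ s * (1/10) ^ (r - 1) * (A ^ 4 / M) := by
  have hA0 : 0 < A := by linarith
  have h1 : A ^ e * (M ^ r)⁻¹ = (A ^ 4 / M) ^ r * (A ^ e / A ^ (4 * r)) := by
    rw [div_pow, ← pow_mul]
    field_simp
  have h2 : A ^ e / A ^ (4 * r) ≤ (1/2) ^ s := by
    rw [div_le_iff₀ (by positivity)]
    calc A ^ e = (1/2) ^ s * (2 ^ s * A ^ e) := by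
          rw [← mul_assoc, ← mul_pow]; norm_num
      _ ≤ (1/2) ^ s * (A ^ s * A ^ e) := by gcongr
      _ = (1/2) ^ s * A ^ (e + s) := by ring
      _ ≤ (1/2) ^ s * A ^ (4 * r) := by
          gcongr
          linarith
  have h3 : (A ^ 4 / M) ^ r ≤ (1/10) ^ (r - 1) * (A ^ 4 / M) := by
    obtain ⟨r, rfl⟩ := Nat.exists_eq_add_of_le' hr
    rw [pow_succ, Nat.add_sub_cancel]
    gcongr
  have h4 : ((5:ℝ)/4) ^ t ≤ (5/4) ^ t0 := pow_le_pow_right₀ (by norm_num) ht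
  calc A ^ e * (5/4) ^ t * (M ^ r)⁻¹ = (5/4) ^ t * ((A ^ 4 / M) ^ r * (A ^ e / A ^ (4 * r))) := by
        rw [← h1]; ring
    _ ≤ (5/4) ^ t0 * (((1/10) ^ (r - 1) * (A ^ 4 / M)) * (1/2) ^ s) := by gcongr
    _ = _ := by ring

lemma ptWt_bound (A M : ℝ) (hA : 2 ≤ A) (hM : 0 < M) (hd : A ^ 4 / M ≤ 1 / 10) (t r e : ℕ)
    (ht : t ≠ 0) (hw : ptWt t r e < 1000000000) :
    A ^ e * (5/4) ^ t * (M ^ r)⁻¹ ≤ (ptWt t r e : ℝ) / 100000 * (A ^ 4 / M) := by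
  have hA0 : 0 < A := by linarith
  have hd0 : 0 ≤ A ^ 4 / M := by positivity
  have key := pt_term A M hA hM t
  unfold ptWt at hw ⊢
  have h0 : Nat.beq t 0 = false := by
    rw [← Bool.not_eq_true, Nat.beq_eq]; exact ht
  simp only [h0, cond_false] at hw ⊢
  have hsplit : ∀ r0 t0 e0 : ℕ, (Nat.beq r r0 && (Nat.ble t t0 && Nat.ble e e0)) = true →
      r = r0 ∧ t ≤ t0 ∧ e ≤ e0 := by
    intro r0 t0 e0 h
    simpa only [Bool.and_eq_true, Nat.beq_eq, Nat.ble_eq] using h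
  have fin : ∀ (t0 r0 s : ℕ) (w : ℕ), r = r0 → t ≤ t0 → e + s ≤ 4 * r0 → 1 ≤ r0 →
      (5/4 : ℝ) ^ t0 * (1/2) ^ s * (1/10) ^ (r0 - 1) ≤ (w : ℝ) / 100000 →
      A ^ e * (5/4) ^ t * (M ^ r)⁻¹ ≤ (w : ℝ) / 100000 * (A ^ 4 / M) := by
    intro t0 r0 s w hr ht he h1 hh
    subst hr
    exact (key t0 r e s ht he h1 hd).trans (mul_le_mul_of_nonneg_right hh hd0)
  cases h1 : (Nat.beq r 1 && (Nat.ble t 2 && Nat.ble e 3)) with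
  | true =>
    obtain ⟨a, b, c⟩ := hsplit _ _ _ h1
    exact fin 2 1 1 _ a b (by omega) (by omega) (by norm_num)
  | false =>
  simp only [h1, cond_false] at hw ⊢
  cases h1 : (Nat.beq r 2 && (Nat.ble t 4 && Nat.ble e 6)) with
  | true =>
    obtain ⟨a, b, c⟩ := hsplit _ _ _ h1
    exact fin 4 2 2 _ a b (by omega) (by omega) (by norm_num)
  | false =>
  simp only [h1, cond_false] at hw ⊢
  cases h1 : (Nat.beq r 3 && (Nat.ble t 8 && Nat.ble e 12)) with
  | true =>
    obtain ⟨a, b, c⟩ := hsplit _ _ _ h1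
    exact fin 8 3 0 _ a b (by omega) (by omega) (by norm_num)
  | false =>
  simp only [h1, cond_false] at hw ⊢
  cases h1 : (Nat.beq r 4 && (Nat.ble t 8 && Nat.ble e 16)) with
  | true =>
    obtain ⟨a, b, c⟩ := hsplit _ _ _ h1
    exact fin 8 4 0 _ a b (by omega) (by omega) (by norm_num)
  | false =>
  simp only [h1, cond_false] at hw ⊢
  cases h1 : (Nat.beq r 5 && (Nat.ble t 8 && Nat.ble e 20)) with
  | true =>
    obtain ⟨a, b, c⟩ := hsplit _ _ _ h1
    exact fin 8 5 0 _ a b (by omega) (by omega) (by norm_num)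
  | false =>
  simp only [h1, cond_false] at hw ⊢
  cases h1 : (Nat.beq r 6 && (Nat.ble t 8 && Nat.ble e 24)) with
  | true =>
    obtain ⟨a, b, c⟩ := hsplit _ _ _ h1
    exact fin 8 6 0 _ a b (by omega) (by omega) (by norm_num)
  | false =>
  simp only [h1, cond_false] at hw
  omega

def ptCanF : Finset (Fin 4 → Fin 4) := univ.filter (fun p => ptToL p ∈ ptCanL)

lemma ptCanF_sum : ∑ p ∈ ptCanF, ∑ q ∈ ptCanF, ptW (ptToL p) (ptToL q) ≤ 1467901 := by
  have hnd : ptCanL.Nodup := by decide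
  have h : ∀ g : List ℕ → ℕ, ∑ p ∈ ptCanF, g (ptToL p) ≤ (ptCanL.map g).sum := by
    intro g
    rw [← List.sum_toFinset _ hnd, ← Finset.sum_image (f := g) (fun a _ b _ h => ptToL_inj h)]
    apply Finset.sum_le_sum_of_subset
    intro l hl
    obtain ⟨p, hp, rfl⟩ := Finset.mem_image.1 hl
    simpa [ptCanF] using hp
  calc _ ≤ ∑ p ∈ ptCanF, (ptCanL.map (fun l' => ptW (ptToL p) l')).sum :=
        Finset.sum_le_sum fun p _ => h (fun l' => ptW (ptToL p) l')
    _ ≤ _ := h (fun l => (ptCanL.map (fun l' => ptW l l')).sum)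
    _ ≤ _ := Nat.ble_eq ▸ ptW_sum

lemma pt_W8 {M : ℕ} (hM : 0 < M) (A : ℝ) (hA : 2 ≤ A) (hd : A ^ 4 / M ≤ 1 / 10) :
    𝔼 u : Fin 4 → Fin M, 𝔼 v : Fin 4 → Fin M,
      A ^ (8 - ptC8 u v) * (5/4 * A) ^ (ptT8 u v) ≤ 1 + 14.68 * (A ^ 4 / M) := by
  have hA0 : 0 < A := by linarith
  have hM' : (0:ℝ) < M := by exact_mod_cast hM
  haveI : Nonempty (Fin M) := ⟨⟨0, hM⟩⟩
  let g : (Fin 4 → Fin 4) → (Fin 4 → Fin 4) → ℝ := fun p q =>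
    if ptT8 p q = 0 then 0 else A ^ (8 - ptC8 p q) * (5/4 * A) ^ (ptT8 p q)
  have hg0 : ∀ p q, 0 ≤ g p q := by
    intro p q
    simp only [g]
    split_ifs <;> positivity
  have h1 : ∀ u v : Fin 4 → Fin M, A ^ (8 - ptC8 u v) * (5/4 * A) ^ (ptT8 u v) ≤
      1 + g (ptcan u) (ptcan v) := by
    intro u v
    rw [ptC8_can, ptT8_can]
    simp only [g]
    split_ifs with h
    · have h8 : ptC8 (ptcan u) (ptcan v) = 8 := by
        rw [ptC8, Finset.card_image_of_injective]
        · simp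
        · intro e e' hee
          by_contra hne
          rw [ptT8, Finset.card_eq_zero] at h
          have : e' ∈ ptT (ptCell8 (ptcan u) (ptcan v)) := by
            simp only [ptT, Finset.mem_filter, Finset.mem_univ, true_and]
            exact ⟨e, hne, hee⟩
          rw [h] at this
          simp at this
      rw [h8, h]
      simp
    · linarith
  have h2 : ∀ u v : Fin 4 → Fin M, g (ptcan u) (ptcan v) =
      ∑ p ∈ ptCanF, ∑ q ∈ ptCanF, g p q * ((if ptcan u = p then 1 else 0) * (if ptcan v = q then 1 else 0)) := by
    intro u v
    have hu : ptcan u ∈ ptCanF := by simp [ptCanF, ptcan_mem]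
    have hv : ptcan v ∈ ptCanF := by simp [ptCanF, ptcan_mem]
    rw [Finset.sum_eq_single_of_mem _ hu, Finset.sum_eq_single_of_mem _ hv]
    · simp
    · intro q _ hq
      rw [if_neg (Ne.symm hq)]
      simp
    · intro p _ hp
      rw [if_neg (Ne.symm hp)]
      simp
  have h3 : 𝔼 u : Fin 4 → Fin M, 𝔼 v : Fin 4 → Fin M, g (ptcan u) (ptcan v) =
      ∑ p ∈ ptCanF, ∑ q ∈ ptCanF, g p q *
        ((𝔼 u : Fin 4 → Fin M, (if ptcan u = p then 1 else 0 : ℝ)) *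
         (𝔼 v : Fin 4 → Fin M, (if ptcan v = q then 1 else 0 : ℝ))) := by
    simp_rw [h2, Finset.expect_mul_expect, Finset.mul_expect]
    simp_rw [Finset.expect_sum_comm]
  have h4 : ∀ p ∈ ptCanF, ∀ q ∈ ptCanF, g p q *
        ((𝔼 u : Fin 4 → Fin M, (if ptcan u = p then 1 else 0 : ℝ)) *
         (𝔼 v : Fin 4 → Fin M, (if ptcan v = q then 1 else 0 : ℝ))) ≤
         (ptW (ptToL p) (ptToL q) : ℝ) / 100000 * (A ^ 4 / M) := by
    intro p hp q hq
    have hw : ptW (ptToL p) (ptToL q) < 1000000000 := by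
      have a1 : ptW (ptToL p) (ptToL q) ≤ ∑ q ∈ ptCanF, ptW (ptToL p) (ptToL q) :=
        Finset.single_le_sum (f := fun q => ptW (ptToL p) (ptToL q)) (fun _ _ => Nat.zero_le _) hq
      have a2 : ∑ q ∈ ptCanF, ptW (ptToL p) (ptToL q) ≤ ∑ p ∈ ptCanF, ∑ q ∈ ptCanF, ptW (ptToL p) (ptToL q) :=
        Finset.single_le_sum (f := fun p => ∑ q ∈ ptCanF, ptW (ptToL p) (ptToL q)) (fun _ _ => Nat.zero_le _) hp
      have := ptCanF_sum
      omega
    by_cases ht : ptT8 p q = 0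
    · simp only [g, if_pos ht, zero_mul]
      positivity
    · have hb := ptWt_bound A M hA hM' hd _ _ _ (by rw [ptT8_eq]; exact ht) hw
      refine le_trans ?_ hb
      rw [ptT8_eq, ptC8_eq, ptIm_eq, ptIm_eq]
      simp only [g, if_neg ht]
      have e1 : 0 ≤ 𝔼 v : Fin 4 → Fin M, (if ptcan v = q then 1 else 0 : ℝ) :=
        Finset.expect_nonneg fun x _ => by split_ifs <;> norm_num
      calc _ ≤ A ^ (8 - ptC8 p q) * (5/4 * A) ^ (ptT8 p q) *
            (((M:ℝ) ^ (4 - (univ.image p).card))⁻¹ * ((M:ℝ) ^ (4 - (univ.image q).card))⁻¹) := by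
            refine mul_le_mul_of_nonneg_left ?_ (by positivity)
            exact mul_le_mul (pt_prob hM p) (pt_prob hM q) e1 (by positivity)
        _ = _ := by
            rw [← mul_inv, ← pow_add, mul_pow, pow_add]
            ring
  calc _ ≤ 𝔼 u : Fin 4 → Fin M, 𝔼 v : Fin 4 → Fin M, (1 + g (ptcan u) (ptcan v)) :=
        Finset.expect_le_expect fun u _ => Finset.expect_le_expect fun v _ => h1 u v
    _ = 1 + 𝔼 u : Fin 4 → Fin M, 𝔼 v : Fin 4 → Fin M, g (ptcan u) (ptcan v) := by
        simp [Finset.expect_add_distrib]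
    _ ≤ _ := by
        rw [h3]
        have : ∑ p ∈ ptCanF, ∑ q ∈ ptCanF, (ptW (ptToL p) (ptToL q) : ℝ) / 100000 * (A ^ 4 / M) ≤
            14.68 * (A ^ 4 / M) := by
          simp_rw [← Finset.sum_mul, ← Finset.sum_div]
          refine mul_le_mul_of_nonneg_right ?_ (by positivity)
          have : (∑ p ∈ ptCanF, ∑ q ∈ ptCanF, (ptW (ptToL p) (ptToL q) : ℝ)) ≤ 1467901 := by
            exact_mod_cast ptCanF_sum
          linarith
        have h5 := Finset.sum_le_sum fun p hp => Finset.sum_le_sum fun q hq => h4 p hp q hq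
        linarith


section full
variable {n M : ℕ}

def ptCell (p : Fin n → Bool → Fin M) (u v : Fin 4 → Fin M) (e : (Fin n → Bool) × (Fin 4 × Bool)) :
    Fin (n + 2) → Fin M :=
  Fin.cons (ptCell8 u v e.2).1 (Fin.cons (ptCell8 u v e.2).2 (fun j => p j (e.1 j)))

lemma ptCell_eq_iff (p : Fin n → Bool → Fin M) (hp : ∀ j, p j false ≠ p j true)
    (u v : Fin 4 → Fin M) (e e') :
    ptCell p u v e = ptCell p u v e' ↔ e.1 = e'.1 ∧ ptCell8 u v e.2 = ptCell8 u v e'.2 := by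
  unfold ptCell
  rw [Fin.cons_inj, Fin.cons_inj]
  constructor
  · rintro ⟨h1, h2, h3⟩
    refine ⟨?_, Prod.ext h1 h2⟩
    funext j
    have := congrFun h3 j
    have hj := hp j
    cases ha : e.1 j <;> cases hb : e'.1 j <;> simp_all
  · rintro ⟨h1, h2⟩
    rw [h1, h2]
    simp

/-- the per-coordinate weight -/
noncomputable def ptw (A lam : ℝ) (p : Fin n → Bool → Fin M) (u v : Fin 4 → Fin M) : ℝ :=
  (∏ j, if p j false = p j true then (A ^ 14)⁻¹ else 1) *
    ((2:ℝ) ^ (Fintype.card ((Fin n → Bool) × (Fin 4 × Bool)) - (univ.image (ptCell p u v)).card) *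
      lam ^ (ptT (ptCell p u v)).card)

lemma ptE_card : Fintype.card ((Fin n → Bool) × (Fin 4 × Bool)) = 2 ^ n * 8 := by
  simp

lemma pt_point (lam : ℝ) (hlam : 1 ≤ lam) (hL : lam ^ (2 ^ n) = 5/4 * 2 ^ (2 ^ n))
    (p : Fin n → Bool → Fin M) (u v : Fin 4 → Fin M) :
    ptw (2 ^ (2 ^ n)) lam p u v ≤
      (2 ^ (2 ^ n)) ^ (8 - ptC8 u v) * (5/4 * 2 ^ (2 ^ n)) ^ (ptT8 u v) +
      ∑ j, if p j false = p j true then (5/4 : ℝ) ^ 8 * (2 ^ (2 ^ n)) ^ 2 else 0 := by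
  set A : ℝ := 2 ^ (2 ^ n) with hAdef
  have hA : 1 ≤ A := one_le_pow₀ (by norm_num)
  have hA0 : 0 < A := by linarith
  have hsum0 : 0 ≤ ∑ j, if p j false = p j true then (5/4 : ℝ) ^ 8 * A ^ 2 else 0 :=
    Finset.sum_nonneg fun j _ => by split_ifs <;> positivity
  unfold ptw
  rw [ptE_card]
  by_cases hp : ∀ j, p j false ≠ p j true
  · have h1 : (∏ j, if p j false = p j true then (A ^ 14)⁻¹ else 1) = 1 :=
      Finset.prod_eq_one fun j _ => if_neg (hp j)
    have h2 : 2 ^ n * ptC8 u v ≤ (univ.image (ptCell p u v)).card := by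
      have := pt_image_le (fun e : (Fin n → Bool) × (Fin 4 × Bool) => (e.1, ptCell8 u v e.2)) (ptCell p u v)
        (fun e e' h => by
          have := (ptCell_eq_iff p hp u v e e').1 h
          exact Prod.ext this.1 this.2)
      refine le_trans (le_of_eq ?_) this
      have : univ.image (fun e : (Fin n → Bool) × (Fin 4 × Bool) => (e.1, ptCell8 u v e.2)) =
          univ ×ˢ (univ.image (ptCell8 u v)) := by
        ext ⟨a, b⟩
        simp
      rw [this, Finset.card_product, ptC8]
      simp
    have h3 : (ptT (ptCell p u v)).card ≤ 2 ^ n * ptT8 u v := by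
      have : ptT (ptCell p u v) ⊆ univ ×ˢ ptT (ptCell8 u v) := by
        intro e he
        simp only [ptT, Finset.mem_filter, Finset.mem_univ, true_and] at he
        obtain ⟨e', hne, h⟩ := he
        have := (ptCell_eq_iff p hp u v e' e).1 h
        simp only [ptT, Finset.mem_product, Finset.mem_univ, true_and, Finset.mem_filter]
        exact ⟨e'.2, fun h2 => hne (Prod.ext this.1 h2), this.2⟩
      refine (Finset.card_le_card this).trans (le_of_eq ?_)
      rw [Finset.card_product, ptT8]
      simp
    rw [h1, one_mul]
    have h4 : (2:ℝ) ^ (2 ^ n * 8 - (univ.image (ptCell p u v)).card) ≤ A ^ (8 - ptC8 u v) := by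
      rw [hAdef, ← pow_mul]
      apply pow_le_pow_right₀ (by norm_num)
      rw [Nat.mul_sub]
      omega
    have h5 : lam ^ (ptT (ptCell p u v)).card ≤ (5/4 * A) ^ (ptT8 u v) := by
      rw [← hL, ← pow_mul]
      exact pow_le_pow_right₀ hlam h3
    have : (2:ℝ) ^ (2 ^ n * 8 - (univ.image (ptCell p u v)).card) * lam ^ (ptT (ptCell p u v)).card
        ≤ A ^ (8 - ptC8 u v) * (5/4 * A) ^ (ptT8 u v) := by
      gcongr
    linarith
  · push Not at hp
    obtain ⟨j, hj⟩ := hp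
    have h1 : (∏ j, if p j false = p j true then (A ^ 14)⁻¹ else 1) ≤ (A ^ 14)⁻¹ := by
      rw [← Finset.mul_prod_erase univ _ (Finset.mem_univ j), if_pos hj]
      refine mul_le_of_le_one_right (by positivity) ?_
      apply Finset.prod_le_one
      · intro i _; split_ifs <;> positivity
      · intro i _
        split_ifs
        · exact inv_le_one_of_one_le₀ (one_le_pow₀ hA)
        · exact le_refl _
    have h2 : (2:ℝ) ^ (2 ^ n * 8 - (univ.image (ptCell p u v)).card) ≤ A ^ 8 := by
      rw [hAdef, ← pow_mul]
      exact pow_le_pow_right₀ (by norm_num) (Nat.sub_le _ _)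
    have h3 : lam ^ (ptT (ptCell p u v)).card ≤ (5/4 * A) ^ 8 := by
      rw [← hL, ← pow_mul]
      apply pow_le_pow_right₀ hlam
      have := Finset.card_le_univ (ptT (ptCell p u v))
      rwa [ptE_card] at this
    have h4 : (5/4 : ℝ) ^ 8 * A ^ 2 ≤ ∑ j, if p j false = p j true then (5/4 : ℝ) ^ 8 * A ^ 2 else 0 := by
      have := Finset.single_le_sum (f := fun j => if p j false = p j true then (5/4 : ℝ) ^ 8 * A ^ 2 else 0)
        (s := univ) (fun j _ => by split_ifs <;> positivity) (Finset.mem_univ j)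
      simpa only [if_pos hj] using this
    have h5 : 0 ≤ A ^ (8 - ptC8 u v) * (5/4 * A) ^ (ptT8 u v) := by positivity
    calc _ ≤ (A ^ 14)⁻¹ * (A ^ 8 * (5/4 * A) ^ 8) := by gcongr
      _ = (5/4 : ℝ) ^ 8 * A ^ 2 := by field_simp
      _ ≤ _ := by linarith

lemma pt_coll (hM : 0 < M) (j : Fin n) (c : ℝ) :
    𝔼 p : Fin n → Bool → Fin M, (if p j false = p j true then c else 0) = c / M := by
  classical
  have : Nonempty (Fin M) := ⟨⟨0, hM⟩⟩
  have hM' : (M:ℝ) ≠ 0 := by exact_mod_cast hM.ne'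
  have h1 : ∀ p : Fin n → Bool → Fin M, (if p j false = p j true then c else 0) =
      ∏ i, (fun i (f : Bool → Fin M) => if i = j then (if f false = f true then c else 0) else (1:ℝ)) i (p i) := by
    intro p
    simp
  simp_rw [h1]
  rw [pt_pi (fun i (f : Bool → Fin M) => if i = j then (if f false = f true then c else 0) else (1:ℝ))]
  rw [Finset.prod_eq_single j]
  · simp only [if_true]
    rw [pt_bool]
    simp_rw [Fintype.expect_eq_sum_div_card]
    simp
    field_simp
  · intro b _ hb
    simp [hb]
  · simp

lemma pt_Wfull (hM : 0 < M) (lam : ℝ) (hlam : 1 ≤ lam) (hL : lam ^ (2 ^ n) = 5/4 * 2 ^ (2 ^ n))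
    (hd : ((2:ℝ) ^ (2 ^ n)) ^ 4 / M ≤ 1 / 10) :
    𝔼 p : Fin n → Bool → Fin M, 𝔼 u : Fin 4 → Fin M, 𝔼 v : Fin 4 → Fin M, ptw (2 ^ (2 ^ n)) lam p u v ≤
      1 + 14.68 * (((2:ℝ) ^ (2 ^ n)) ^ 4 / M) + n * ((5/4 : ℝ) ^ 8 * (2 ^ (2 ^ n)) ^ 2 / M) := by
  have : Nonempty (Fin M) := ⟨⟨0, hM⟩⟩
  have hA : (2:ℝ) ≤ 2 ^ (2 ^ n) := le_self_pow₀ (by norm_num) (by positivity)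
  calc _ ≤ 𝔼 p : Fin n → Bool → Fin M, 𝔼 u : Fin 4 → Fin M, 𝔼 v : Fin 4 → Fin M,
        ((2 ^ (2 ^ n)) ^ (8 - ptC8 u v) * (5/4 * 2 ^ (2 ^ n)) ^ (ptT8 u v) +
      ∑ j, if p j false = p j true then (5/4 : ℝ) ^ 8 * (2 ^ (2 ^ n)) ^ 2 else 0) :=
        Finset.expect_le_expect fun p _ => Finset.expect_le_expect fun u _ =>
          Finset.expect_le_expect fun v _ => pt_point lam hlam hL p u v
    _ = (𝔼 u : Fin 4 → Fin M, 𝔼 v : Fin 4 → Fin M,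
        (2 ^ (2 ^ n)) ^ (8 - ptC8 u v) * (5/4 * 2 ^ (2 ^ n)) ^ (ptT8 u v)) +
        𝔼 p : Fin n → Bool → Fin M, ∑ j, (if p j false = p j true then (5/4 : ℝ) ^ 8 * (2 ^ (2 ^ n)) ^ 2 else 0) := by
        simp_rw [Finset.expect_add_distrib, Fintype.expect_const]
    _ ≤ _ := by
        refine add_le_add (pt_W8 hM _ hA hd) (le_of_eq ?_)
        rw [Finset.expect_sum_comm]
        simp_rw [pt_coll hM]
        simp
end full


section assemble
variable {n m M : ℕ}

/-- the integrand -/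
noncomputable def ptPhi (n M : ℕ) (φ : (Fin m → Bool) → ℝ) (x : Fin m → (Fin (n + 2) → Fin M) → Bool)
    (y : Fin n → Fin m → Fin M) (u v : Fin m → Fin M) : ℝ :=
  2 ^ m * φ (fun i => x i (Fin.cons (u i) (Fin.cons (v i) (fun j => y j i))))

lemma ptR_bound (d : ℕ) (φ : (Fin m → Bool) → ℝ) (hφ1 : (∑ z, |φ z|) = 1)
    (hφ2 : ∀ T : Finset (Fin m), T.card ≤ d →
      ∑ z, φ z * ∏ i ∈ T, (if z i then 1 else -1 : ℝ) = 0) (lam : ℝ) (hlam : 1 ≤ lam)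
    (h : (Fin n → Fin m → Fin M) → (Fin m → Fin M) → (Fin m → Fin M) → ℝ)
    (hh : ∀ y u v, |h y u v| ≤ 1) (p : Fin n → Bool → Fin m → Fin M) :
    ptR n (fun x y u v => h y u v * ptPhi n M φ x y u v) p ≤
      𝔼 u : Fin 4 → Fin m → Fin M, 𝔼 v : Fin 4 → Fin m → Fin M,
        (∏ i, ((2:ℝ) ^ (Fintype.card ((Fin n → Bool) × (Fin 4 × Bool)) -
            (univ.image (ptCell (fun j b => p j b i) (fun q => u q i) (fun q => v q i))).card) *
          lam ^ (ptT (ptCell (fun j b => p j b i) (fun q => u q i) (fun q => v q i))).card)) *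
        (lam ^ ((2 ^ n * 8) * (d + 1)))⁻¹ := by
  unfold ptR
  refine Finset.expect_le_expect fun u _ => Finset.expect_le_expect fun v _ => ?_
  have key := pt_core d φ hφ1 hφ2
    (fun i => ptCell (fun j b => p j b i) (fun q => u q i) (fun q => v q i)) lam hlam
  rw [ptE_card] at key ⊢
  refine le_trans ?_ key
  set H : ℝ := ∏ l : Fin n → Bool, ∏ q : Fin 4, ∏ b : Bool,
    h (fun j => p j (l j)) (u (q + if b then 1 else 0)) (v q) with hH
  have h1 : |H| ≤ 1 := by
    rw [hH]
    simp_rw [Finset.abs_prod]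
    refine Finset.prod_le_one (fun _ _ => by positivity) fun l _ => ?_
    refine Finset.prod_le_one (fun _ _ => by positivity) fun q _ => ?_
    exact Finset.prod_le_one (fun _ _ => by positivity) fun b _ => hh _ _ _
  simp_rw [Finset.prod_mul_distrib, ← Finset.mul_expect]
  rw [abs_mul]
  refine (mul_le_of_le_one_left (abs_nonneg _) h1).trans (le_of_eq ?_)
  rw [Finset.mul_expect]
  congr 1
  refine Finset.expect_congr rfl fun x _ => ?_
  rw [← Finset.prod_mul_distrib, Fintype.prod_prod_type]
  refine Finset.prod_congr rfl fun l _ => ?_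
  rw [Fintype.prod_prod_type]
  rfl

lemma pt_transpose (W : (Fin n → Bool → Fin M) → (Fin 4 → Fin M) → (Fin 4 → Fin M) → ℝ) :
    𝔼 p : Fin n → Bool → Fin m → Fin M, 𝔼 u : Fin 4 → Fin m → Fin M, 𝔼 v : Fin 4 → Fin m → Fin M,
      ∏ i, W (fun j b => p j b i) (fun q => u q i) (fun q => v q i) =
    (𝔼 p : Fin n → Bool → Fin M, 𝔼 u : Fin 4 → Fin M, 𝔼 v : Fin 4 → Fin M, W p u v) ^ m := by
  have h1 : 𝔼 p : Fin n → Bool → Fin M, 𝔼 u : Fin 4 → Fin M, 𝔼 v : Fin 4 → Fin M, W p u v =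
      𝔼 q : (Fin n → Bool → Fin M) × (Fin 4 → Fin M) × (Fin 4 → Fin M), W q.1 q.2.1 q.2.2 := by
    rw [← pt_prod (fun p (w : (Fin 4 → Fin M) × (Fin 4 → Fin M)) => W p w.1 w.2)]
    refine Finset.expect_congr rfl fun x _ => ?_
    rw [← pt_prod (fun u v => W x u v)]
  have h2 : 𝔼 p : Fin n → Bool → Fin m → Fin M, 𝔼 u : Fin 4 → Fin m → Fin M, 𝔼 v : Fin 4 → Fin m → Fin M,
      ∏ i, W (fun j b => p j b i) (fun q => u q i) (fun q => v q i) =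
      𝔼 q : (Fin n → Bool → Fin m → Fin M) × (Fin 4 → Fin m → Fin M) × (Fin 4 → Fin m → Fin M),
        ∏ i, W (fun j b => q.1 j b i) (fun k => q.2.1 k i) (fun k => q.2.2 k i) := by
    rw [← pt_prod (fun (p : Fin n → Bool → Fin m → Fin M) (w : (Fin 4 → Fin m → Fin M) × (Fin 4 → Fin m → Fin M)) =>
      ∏ i, W (fun j b => p j b i) (fun k => w.1 k i) (fun k => w.2 k i))]
    refine Finset.expect_congr rfl fun x _ => ?_
    rw [← pt_prod (fun (u v : Fin 4 → Fin m → Fin M) => ∏ i, W (fun j b => x j b i) (fun k => u k i) (fun k => v k i))]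
  rw [h1, h2]
  have h3 := pt_pi (ι := Fin m) (fun _ (q : (Fin n → Bool → Fin M) × (Fin 4 → Fin M) × (Fin 4 → Fin M)) =>
    W q.1 q.2.1 q.2.2)
  rw [Finset.prod_const, Finset.card_univ, Fintype.card_fin] at h3
  rw [← h3]
  exact Fintype.expect_equiv
    { toFun := fun q i => (fun j b => q.1 j b i, fun k => q.2.1 k i, fun k => q.2.2 k i)
      invFun := fun f => (fun j b i => (f i).1 j b, fun k i => (f i).2.1 k, fun k i => (f i).2.2 k)
      left_inv := fun _ => rfl
      right_inv := fun _ => rfl } _ _ (fun _ => rfl)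

noncomputable def ptr (A : ℝ) (a b : Fin m → Fin M) : ℝ := ∏ i, if a i = b i then A ^ 2 else 1

lemma ptr_one_le (A : ℝ) (hA : 1 ≤ A) (a b : Fin m → Fin M) : 1 ≤ ptr A a b := by
  unfold ptr
  calc (1:ℝ) = ∏ i : Fin m, (1:ℝ) := by simp
    _ ≤ _ := Finset.prod_le_prod (fun _ _ => by norm_num) fun i _ => by
      split_ifs
      · exact one_le_pow₀ hA
      · exact le_refl _

lemma ptr_expect (hM : 0 < M) (A : ℝ) (hA : 1 ≤ A) :
    𝔼 a : Fin m → Fin M, 𝔼 b : Fin m → Fin M, ptr A a b ≤ Real.exp (m * (A ^ 2 / M)) := by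
  have : Nonempty (Fin M) := ⟨⟨0, hM⟩⟩
  have hM' : (0:ℝ) < M := by exact_mod_cast hM
  have h1 : ∀ a : Fin m → Fin M, 𝔼 b : Fin m → Fin M, ptr A a b = (1 + (A ^ 2 - 1) / M) ^ m := by
    intro a
    unfold ptr
    rw [pt_pi (fun i (c : Fin M) => if a i = c then A ^ 2 else 1)]
    have : ∀ i, 𝔼 c, (if a i = c then A ^ 2 else 1) = (1 + (A ^ 2 - 1) / M) := by
      intro i
      have e : ∀ c, (if a i = c then A ^ 2 else 1) = 1 + (if a i = c then A ^ 2 - 1 else 0) := by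
        intro c; split_ifs <;> ring
      simp_rw [e, Finset.expect_add_distrib]
      rw [Fintype.expect_eq_sum_div_card (fun c => if a i = c then A ^ 2 - 1 else 0)]
      simp
    simp_rw [this]
    simp
  simp_rw [h1]
  rw [Fintype.expect_const, Real.exp_nat_mul]
  have h0 : 0 ≤ (A ^ 2 - 1) / M := by
    apply div_nonneg _ hM'.le
    nlinarith
  refine pow_le_pow_left₀ (by linarith) ?_ m
  have h2 : (A ^ 2 - 1) / M ≤ A ^ 2 / M := by gcongr; linarith
  have := Real.add_one_le_exp (A ^ 2 / M)
  linarith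

lemma pt_num1 (n : ℕ) : 16 * n ≤ 4 ^ (2 ^ n) ∧ 4 * 2 ^ n ≤ 4 ^ (2 ^ n) := by
  have h1 : ∀ L : ℕ, 1 ≤ L → 4 * L ≤ 4 ^ L ∧ 16 * (L - 1) ≤ 4 ^ L := by
    intro L hL
    induction L, hL using Nat.le_induction with
    | base => simp
    | succ L hL ih => rw [pow_succ]; omega
  have := h1 (2 ^ n) Nat.one_le_two_pow
  have h2 : n < 2 ^ n := Nat.lt_two_pow_self
  omega

lemma pt_big (d : ℕ) (hM : 0 < M) (φ : (Fin m → Bool) → ℝ) (hφ1 : (∑ z, |φ z|) = 1)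
    (hφ2 : ∀ T : Finset (Fin m), T.card ≤ d →
      ∑ z, φ z * ∏ i ∈ T, (if z i then 1 else -1 : ℝ) = 0)
    (hd : ((2:ℝ) ^ (2 ^ n)) ^ 4 / M ≤ 1 / 10)
    (hbig : 4 * Real.exp 1 * (m * (((2:ℝ) ^ (2 ^ n)) ^ 4 / M)) ≤ d)
    (h : (Fin n → Fin m → Fin M) → (Fin m → Fin M) → (Fin m → Fin M) → ℝ)
    (hh : ∀ y u v, |h y u v| ≤ 1)
    (Z : Fin n → (Fin m → (Fin (n + 2) → Fin M) → Bool) → (Fin n → Fin m → Fin M) →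
      (Fin m → Fin M) → (Fin m → Fin M) → ℝ)
    (s t : (Fin m → (Fin (n + 2) → Fin M) → Bool) → (Fin n → Fin m → Fin M) →
      (Fin m → Fin M) → (Fin m → Fin M) → ℝ)
    (hZ : ∀ j x y u v, |Z j x y u v| ≤ 1) (hs : ∀ x y u v, |s x y u v| ≤ 1)
    (ht : ∀ x y u v, |t x y u v| ≤ 1)
    (hZ' : ∀ j x y y' u v, (∀ j', j' ≠ j → y j' = y' j') → Z j x y u v = Z j x y' u v)
    (hs' : ∀ x y u u' v, s x y u v = s x y u' v)
    (ht' : ∀ x y u v v', t x y u v = t x y u v') :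
    |𝔼 x, 𝔼 y, 𝔼 u, 𝔼 v, (h y u v * ptPhi n M φ x y u v) * (∏ j, Z j x y u v) * s x y u v * t x y u v|
      ≤ (1/2) ^ d := by
  have : Nonempty (Fin M) := ⟨⟨0, hM⟩⟩
  have hM' : (0:ℝ) < M := by exact_mod_cast hM
  set A : ℝ := 2 ^ (2 ^ n) with hAdef
  have hA1 : 1 ≤ A := one_le_pow₀ (by norm_num)
  have hA0 : 0 < A := by linarith
  have hL0 : (2 ^ n : ℕ) ≠ 0 := by positivity
  obtain ⟨lam, hlam0, hL⟩ : ∃ lam : ℝ, 0 ≤ lam ∧ lam ^ (2 ^ n) = 5/4 * A :=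
    ⟨(5/4 * A) ^ (((2 ^ n : ℕ) : ℝ)⁻¹), by positivity, Real.rpow_inv_natCast_pow (by positivity) hL0⟩
  have hlam : 1 ≤ lam := by
    by_contra hlt
    push Not at hlt
    have := pow_lt_one₀ hlam0 hlt hL0
    linarith
  have ind := pt_ind (ptr A) (ptr_one_le A hA1) n (fun x y u v => h y u v * ptPhi n M φ x y u v)
    Z s t hZ hs ht hZ' hs' ht'
  set I := 𝔼 x, 𝔼 y, 𝔼 u, 𝔼 v, (h y u v * ptPhi n M φ x y u v) * (∏ j, Z j x y u v) * s x y u v * t x y u v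
    with hI
  set V := 𝔼 a : Fin m → Fin M, 𝔼 b : Fin m → Fin M, ptr A a b with hV
  have hV0 : 0 ≤ V := Finset.expect_nonneg fun a _ => Finset.expect_nonneg fun b _ => by
    linarith [ptr_one_le A hA1 a b]
  set W := 𝔼 p : Fin n → Bool → Fin M, 𝔼 u : Fin 4 → Fin M, 𝔼 v : Fin 4 → Fin M, ptw A lam p u v with hW
  have e1 : 𝔼 p : Fin n → Bool → Fin m → Fin M, (∏ j, (ptr A (p j false) (p j true))⁻¹ ^ 7) *
      ptR n (fun x y u v => h y u v * ptPhi n M φ x y u v) p ≤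
      W ^ m * (lam ^ ((2 ^ n * 8) * (d + 1)))⁻¹ := by
    rw [hW, ← pt_transpose (m := m)]
    rw [Finset.expect_mul]
    refine Finset.expect_le_expect fun p _ => ?_
    have hpos : 0 ≤ ∏ j, (ptr A (p j false) (p j true))⁻¹ ^ 7 :=
      Finset.prod_nonneg fun j _ => by
        have := ptr_one_le A hA1 (p j false) (p j true)
        positivity
    refine (mul_le_mul_of_nonneg_left (ptR_bound d φ hφ1 hφ2 lam hlam h hh p) hpos).trans (le_of_eq ?_)
    rw [Finset.mul_expect, Finset.expect_mul]
    refine Finset.expect_congr rfl fun u _ => ?_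
    rw [Finset.mul_expect, Finset.expect_mul]
    refine Finset.expect_congr rfl fun v _ => ?_
    rw [← mul_assoc]
    congr 1
    unfold ptw
    conv_rhs => rw [Finset.prod_mul_distrib]
    congr 1
    conv_rhs => rw [Finset.prod_comm]
    refine Finset.prod_congr rfl fun j _ => ?_
    unfold ptr
    rw [← Finset.prod_inv_distrib, ← Finset.prod_pow]
    refine Finset.prod_congr rfl fun i _ => ?_
    split_ifs
    · rw [inv_pow, ← pow_mul]
    · simp
  have hWle := pt_Wfull (n := n) hM lam hlam hL hd
  rw [← hAdef, ← hW] at hWle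
  have hW0 : 0 ≤ W := Finset.expect_nonneg fun a _ => Finset.expect_nonneg fun b _ =>
    Finset.expect_nonneg fun c _ => by
      unfold ptw
      refine mul_nonneg (Finset.prod_nonneg fun j _ => ?_) (by positivity)
      split_ifs <;> positivity
  have hVle := ptr_expect (m := m) hM A hA1
  rw [← hV] at hVle
  set δ := A ^ 4 / M with hδ
  have hδ0 : 0 ≤ δ := by positivity
  obtain ⟨num1, num2⟩ := pt_num1 n
  have hA2 : A ^ 2 = 4 ^ (2 ^ n) := by
    rw [hAdef, ← pow_mul, mul_comm, pow_mul]; norm_num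
  have num1' : 16 * (n:ℝ) ≤ A ^ 2 := by rw [hA2]; exact_mod_cast num1
  have num2' : 4 * (2:ℝ) ^ n ≤ A ^ 2 := by rw [hA2]; exact_mod_cast num2
  have f1 : (n:ℝ) * ((5/4 : ℝ) ^ 8 * A ^ 2 / M) ≤ 0.375 * δ := by
    have : (n:ℝ) * ((5/4 : ℝ) ^ 8 * A ^ 2 / M) = (16 * n) * ((5/4 : ℝ) ^ 8 / 16 * (A ^ 2 / M)) := by ring
    rw [this]
    calc _ ≤ A ^ 2 * ((5/4 : ℝ) ^ 8 / 16 * (A ^ 2 / M)) := by gcongr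
      _ = ((5/4 : ℝ) ^ 8 / 16) * δ := by rw [hδ]; ring
      _ ≤ _ := by
        apply mul_le_mul_of_nonneg_right _ hδ0
        norm_num
  have f2 : ((8 * 2 ^ n : ℕ) : ℝ) * (m * (A ^ 2 / M)) ≤ m * (2 * δ) := by
    push_cast
    calc (8 * (2:ℝ) ^ n) * (m * (A ^ 2 / M)) = (4 * 2 ^ n) * (2 * (m * (A ^ 2 / M))) := by ring
      _ ≤ A ^ 2 * (2 * (m * (A ^ 2 / M))) := by gcongr
      _ = _ := by rw [hδ]; ring
  have g1 : V ^ (8 * 2 ^ n) ≤ Real.exp (m * (2 * δ)) := by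
    calc V ^ (8 * 2 ^ n) ≤ (Real.exp (m * (A ^ 2 / M))) ^ (8 * 2 ^ n) := pow_le_pow_left₀ hV0 hVle _
      _ = Real.exp (((8 * 2 ^ n : ℕ) : ℝ) * (m * (A ^ 2 / M))) := (Real.exp_nat_mul _ _).symm
      _ ≤ _ := Real.exp_le_exp.2 f2
  have g2 : W ^ m ≤ Real.exp (m * (15.055 * δ)) := by
    rw [Real.exp_nat_mul]
    refine pow_le_pow_left₀ hW0 ?_ m
    have := Real.add_one_le_exp (15.055 * δ)
    linarith
  have hlamF : lam ^ ((2 ^ n * 8) * (d + 1)) = ((5/4 : ℝ) ^ (d + 1)) ^ 8 * (2 ^ (d + 1)) ^ (8 * 2 ^ n) := by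
    rw [pow_mul, pow_mul, hL, hAdef, mul_pow, mul_pow, ← pow_mul, ← pow_mul, ← pow_mul, ← pow_mul]
    ring
  have g3 : Real.exp (m * (2 * δ)) * Real.exp (m * (15.055 * δ)) ≤ ((5/4 : ℝ) ^ (d + 1)) ^ 8 := by
    rw [← Real.exp_add]
    have e54 : Real.exp (1/5) ≤ 5/4 := by
      have := Real.add_one_le_exp (-(1/5) : ℝ)
      rw [Real.exp_neg] at this
      have hp := Real.exp_pos (1/5 : ℝ)
      rw [le_inv_comm₀ (by norm_num) hp] at this
      norm_num at this ⊢
      linarith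
    have hmd : m * (2 * δ) + m * (15.055 * δ) ≤ ((8 * d : ℕ) : ℝ) * (1/5) := by
      have he := Real.exp_one_gt_d9
      have hmd0 : 0 ≤ m * δ := by positivity
      push_cast
      nlinarith
    calc _ ≤ Real.exp (((8 * d : ℕ) : ℝ) * (1/5)) := Real.exp_le_exp.2 hmd
      _ = (Real.exp (1/5)) ^ (8 * d) := Real.exp_nat_mul _ _
      _ ≤ (5/4 : ℝ) ^ (8 * d) := pow_le_pow_left₀ (Real.exp_pos _).le e54 _
      _ ≤ (5/4 : ℝ) ^ ((d + 1) * 8) := pow_le_pow_right₀ (by norm_num) (by omega)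
      _ = _ := pow_mul _ _ _
  have hfin : |I| ^ (8 * 2 ^ n) ≤ ((1/2 : ℝ) ^ (d + 1)) ^ (8 * 2 ^ n) := by
    have hev : Even (8 * 2 ^ n) := ⟨4 * 2 ^ n, by ring⟩
    rw [hev.pow_abs]
    refine ind.trans ?_
    calc _ ≤ V ^ (8 * 2 ^ n) * (W ^ m * (lam ^ ((2 ^ n * 8) * (d + 1)))⁻¹) := by gcongr
      _ ≤ Real.exp (m * (2 * δ)) * (Real.exp (m * (15.055 * δ)) * (lam ^ ((2 ^ n * 8) * (d + 1)))⁻¹) := by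
        gcongr
      _ = (Real.exp (m * (2 * δ)) * Real.exp (m * (15.055 * δ))) * (lam ^ ((2 ^ n * 8) * (d + 1)))⁻¹ := by ring
      _ ≤ ((5/4 : ℝ) ^ (d + 1)) ^ 8 * (lam ^ ((2 ^ n * 8) * (d + 1)))⁻¹ := by gcongr
      _ = _ := by
        rw [hlamF]
        rw [one_div, inv_pow, inv_pow, mul_inv, ← mul_assoc, mul_inv_cancel₀ (by positivity), one_mul]
  have := (pow_le_pow_iff_left₀ (abs_nonneg I) (by positivity) (by positivity : (8 * 2 ^ n : ℕ) ≠ 0)).1 hfin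
  exact this.trans (pow_le_pow_of_le_one (by norm_num) (by norm_num) (by omega))
end assemble

end ptHelpers

section final
open Finset

lemma pt_sum_eq {k1 m M : ℕ} (φ : (Fin m → Bool) → ℝ) (Z : Set (PatIdx k1 m M)) :
    ∑ p : PatIdx k1 m M, (((2 : ℝ) ^ m / (Fintype.card (PatIdx k1 m M) : ℝ)) * pattP φ p) * Z.indicator 1 p =
    𝔼 x : Fin m → (Fin k1 → Fin M) → Bool, 𝔼 y : Fin k1 → Fin m → Fin M,
      (2 ^ m * φ (fun i => x i (fun j => y j i))) * Z.indicator 1 (x, y) := by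
  rw [pt_prod (fun (x : Fin m → (Fin k1 → Fin M) → Bool) (y : Fin k1 → Fin m → Fin M) =>
      (2 ^ m * φ (fun i => x i (fun j => y j i))) * Z.indicator 1 (x, y))]
  rw [Fintype.expect_eq_sum_div_card, Finset.sum_div]
  refine Finset.sum_congr rfl fun p _ => ?_
  unfold pattP
  ring

lemma pt_cylfun {k1 m M : ℕ} (Z : Set (PatIdx k1 m M)) (hZ : IsCylIntP k1 m M Z) :
    ∃ (g : (Fin k1 → Fin m → Fin M) → ℝ)
      (G : Fin k1 → (Fin m → (Fin k1 → Fin M) → Bool) → (Fin k1 → Fin m → Fin M) → ℝ),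
      (∀ y, |g y| ≤ 1) ∧ (∀ j x y, |G j x y| ≤ 1) ∧
      (∀ j x y y', (∀ j', j' ≠ j → y j' = y' j') → G j x y = G j x y') ∧
      ∀ x y, Z.indicator (1 : PatIdx k1 m M → ℝ) (x, y) = g y * ∏ j, G j x y := by
  classical
  obtain ⟨Z0, ZY, h0, hY, rfl⟩ := hZ
  refine ⟨fun y => if ((fun _ _ => false, y) : PatIdx k1 m M) ∈ Z0 then 1 else 0,
    fun j x y => if ((x, y) : PatIdx k1 m M) ∈ ZY j then 1 else 0, ?_, ?_, ?_, ?_⟩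
  · intro y; dsimp only; split_ifs <;> simp
  · intro j x y; dsimp only; split_ifs <;> simp
  · intro j x y y' h
    have : ((x, y) : PatIdx k1 m M) ∈ ZY j ↔ ((x, y') : PatIdx k1 m M) ∈ ZY j :=
      ⟨hY j x y y' h, hY j x y' y fun j' hj' => (h j' hj').symm⟩
    simp only [this]
  · intro x y
    have e : ((fun _ _ => false, y) : PatIdx k1 m M) ∈ Z0 ↔ ((x, y) : PatIdx k1 m M) ∈ Z0 :=
      ⟨h0 _ _ _, h0 _ _ _⟩
    simp only [e, Set.indicator_apply, Set.mem_inter_iff, Set.mem_iInter, Pi.one_apply,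
      Finset.prod_ite_zero, Finset.prod_const_one]
    by_cases h1 : ((x, y) : PatIdx k1 m M) ∈ Z0 <;> simp [h1]

lemma pt_abs_expect {ι : Type} [Fintype ι] (f : ι → ℝ) : |𝔼 i, f i| ≤ 𝔼 i, |f i| :=
  Finset.abs_expect_le _ _

lemma pt_trivial {k1 m M : ℕ} (φ : (Fin m → Bool) → ℝ) (hφ1 : (∑ z, |φ z|) = 1)
    (I : (Fin m → (Fin k1 → Fin M) → Bool) → (Fin k1 → Fin m → Fin M) → ℝ)
    (hI : ∀ x y, |I x y| ≤ 1) :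
    |𝔼 x : Fin m → (Fin k1 → Fin M) → Bool, 𝔼 y : Fin k1 → Fin m → Fin M,
      (2 ^ m * φ (fun i => x i (fun j => y j i))) * I x y| ≤ 1 := by
  rw [Finset.expect_comm]
  have h1 : ∀ y : Fin k1 → Fin m → Fin M, |𝔼 x : Fin m → (Fin k1 → Fin M) → Bool,
      (2 ^ m * φ (fun i => x i (fun j => y j i))) * I x y| ≤ 1 := by
    intro y
    refine (pt_abs_expect _).trans ?_
    have key := pt_core_bound (E := Unit) (fun z => |φ z|) (by simpa using hφ1)
      (fun i (_ : Unit) => (fun j => y j i))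
    have e : ∀ i : Fin m, (univ.image (fun _ : Unit => (fun j => y j i))).card = 1 := by
      intro i; simp
    simp only [e] at key
    simp only [univ_unique, prod_singleton, Fintype.card_unit, Nat.sub_self, pow_zero,
      prod_const_one] at key
    refine le_trans ?_ ((le_abs_self _).trans key)
    refine Finset.expect_le_expect fun x _ => ?_
    rw [abs_mul, abs_mul]
    have : |(2:ℝ) ^ m| = 2 ^ m := abs_of_pos (by positivity)
    rw [this]
    exact mul_le_of_le_one_right (by positivity) (hI x y)
  refine (pt_abs_expect _).trans ?_
  refine (Finset.expect_le_expect fun y _ => h1 y).trans ?_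
  rw [Fintype.expect_eq_sum_div_card]
  simp [div_self_le_one]

lemma pt_lt {m : ℕ} (d : ℕ) (φ : (Fin m → Bool) → ℝ) (hφ1 : (∑ z, |φ z|) = 1)
    (hφ2 : ∀ T : Finset (Fin m), T.card ≤ d →
      ∑ z, φ z * ∏ i ∈ T, (if z i then 1 else -1 : ℝ) = 0) : d < m := by
  by_contra h
  push Not at h
  have h0 : ∀ z, φ z = 0 := by
    intro z
    have := pt_vanish d φ hφ2 univ (by simpa using h) z
    simpa using this
  simp [h0] at hφ1

lemma pt_main_big {n m M : ℕ} (d : ℕ) (hM : 0 < M) (φ : (Fin m → Bool) → ℝ) (hφ1 : (∑ z, |φ z|) = 1)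
    (hφ2 : ∀ T : Finset (Fin m), T.card ≤ d →
      ∑ z, φ z * ∏ i ∈ T, (if z i then 1 else -1 : ℝ) = 0)
    (hd : ((2:ℝ) ^ (2 ^ n)) ^ 4 / M ≤ 1 / 10)
    (hbig : 4 * Real.exp 1 * (m * (((2:ℝ) ^ (2 ^ n)) ^ 4 / M)) ≤ d)
    (g : (Fin (n+2) → Fin m → Fin M) → ℝ)
    (G : Fin (n+2) → (Fin m → (Fin (n+2) → Fin M) → Bool) → (Fin (n+2) → Fin m → Fin M) → ℝ)
    (hg : ∀ y, |g y| ≤ 1) (hG : ∀ j x y, |G j x y| ≤ 1)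
    (hG' : ∀ j x y y', (∀ j', j' ≠ j → y j' = y' j') → G j x y = G j x y') :
    |𝔼 x : Fin m → (Fin (n+2) → Fin M) → Bool, 𝔼 y : Fin (n+2) → Fin m → Fin M,
      (2 ^ m * φ (fun i => x i (fun j => y j i))) * (g y * ∏ j, G j x y)| ≤ (1/2) ^ d := by
  have key := pt_big (n := n) d hM φ hφ1 hφ2 hd hbig
    (fun y u v => g (Fin.cons u (Fin.cons v y))) (fun y u v => hg _)
    (fun j x y u v => G j.succ.succ x (Fin.cons u (Fin.cons v y)))
    (fun x y u v => G 0 x (Fin.cons u (Fin.cons v y)))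
    (fun x y u v => G 1 x (Fin.cons u (Fin.cons v y)))
    (fun _ _ _ _ _ => hG _ _ _) (fun _ _ _ _ => hG _ _ _) (fun _ _ _ _ => hG _ _ _)
    ?_ ?_ ?_
  · refine le_trans (le_of_eq ?_) key
    congr 1
    refine Finset.expect_congr rfl fun x _ => ?_
    rw [pt_cons]
    have : ∀ u : Fin m → Fin M, 𝔼 f : Fin (n + 1) → Fin m → Fin M,
        (2 ^ m * φ (fun i => x i (fun j => (Fin.cons u f : Fin (n+2) → Fin m → Fin M) j i))) *
          (g (Fin.cons u f) * ∏ j, G j x (Fin.cons u f)) =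
        𝔼 y : Fin n → Fin m → Fin M, 𝔼 v : Fin m → Fin M,
        (2 ^ m * φ (fun i => x i (fun j => (Fin.cons u (Fin.cons v y : Fin (n+1) → Fin m → Fin M) : Fin (n+2) → Fin m → Fin M) j i))) *
          (g (Fin.cons u (Fin.cons v y)) * ∏ j, G j x (Fin.cons u (Fin.cons v y))) := by
      intro u
      rw [pt_cons, Finset.expect_comm]
    simp_rw [this]
    rw [Finset.expect_comm]
    refine Finset.expect_congr rfl fun y _ => ?_
    refine Finset.expect_congr rfl fun u _ => ?_
    refine Finset.expect_congr rfl fun v _ => ?_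
    have hc : ∀ i, (fun j => (Fin.cons u (Fin.cons v y : Fin (n+1) → Fin m → Fin M) : Fin (n+2) → Fin m → Fin M) j i)
        = Fin.cons (u i) (Fin.cons (v i) (fun j => y j i)) := by
      intro i
      funext j
      refine Fin.cases rfl (fun j => ?_) j
      refine Fin.cases rfl (fun j => rfl) j
    simp_rw [hc]
    unfold ptPhi
    rw [Fin.prod_univ_succ, Fin.prod_univ_succ]
    rw [Fin.succ_zero_eq_one]
    ring
  · intro j x y y' u v h
    refine hG' _ _ _ _ fun j' => ?_
    refine Fin.cases (fun _ => rfl) (fun j' => ?_) j'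
    refine Fin.cases (fun _ => rfl) (fun j' hj => ?_) j'
    exact h j' fun e => hj (by rw [e])
  · intro x y u u' v
    refine hG' _ _ _ _ fun j' => ?_
    refine Fin.cases (fun h => absurd rfl h) (fun j' _ => rfl) j'
  · intro x y u v v'
    refine hG' _ _ _ _ fun j' => ?_
    refine Fin.cases (fun _ => rfl) (fun j' => ?_) j'
    refine Fin.cases (fun h => absurd rfl h) (fun j' _ => rfl) j'

lemma pt_mem_ptT {E C : Type} [Fintype E] [DecidableEq E] [DecidableEq C] (cell : E → C) (e : E)
    (h : e ∈ ptT cell) : ∃ e', e' ≠ e ∧ cell e' = cell e :=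
  (Finset.mem_filter.1 h).2

lemma pt_small {m M : ℕ} (d : ℕ) (hM : 0 < M) (φ : (Fin m → Bool) → ℝ) (hφ1 : (∑ z, |φ z|) = 1)
    (hφ2 : ∀ T : Finset (Fin m), T.card ≤ d →
      ∑ z, φ z * ∏ i ∈ T, (if z i then 1 else -1 : ℝ) = 0)
    (hbig : m * (8 * Real.exp 1 / M) ≤ d)
    (g : (Fin 1 → Fin m → Fin M) → ℝ)
    (G : Fin 1 → (Fin m → (Fin 1 → Fin M) → Bool) → (Fin 1 → Fin m → Fin M) → ℝ)
    (hg : ∀ y, |g y| ≤ 1) (hG : ∀ j x y, |G j x y| ≤ 1)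
    (hG' : ∀ j x y y', (∀ j', j' ≠ j → y j' = y' j') → G j x y = G j x y') :
    |𝔼 x : Fin m → (Fin 1 → Fin M) → Bool, 𝔼 y : Fin 1 → Fin m → Fin M,
      (2 ^ m * φ (fun i => x i (fun j => y j i))) * (g y * ∏ j, G j x y)| ≤ (1/2) ^ d := by
  have : Nonempty (Fin M) := ⟨⟨0, hM⟩⟩
  have hM' : (0:ℝ) < M := by exact_mod_cast hM
  let y0 : Fin 1 → Fin m → Fin M := fun _ _ => ⟨0, hM⟩
  have he0 := Real.exp_pos 1
  obtain ⟨lam, hlam0, hL⟩ : ∃ lam : ℝ, 0 ≤ lam ∧ lam ^ 2 = 4 * Real.exp 1 :=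
    ⟨√(4 * Real.exp 1), by positivity, Real.sq_sqrt (by positivity)⟩
  have hlam : 1 ≤ lam := by
    have he := Real.exp_one_gt_d9
    nlinarith
  set F : (Fin m → (Fin 1 → Fin M) → Bool) → (Fin 1 → Fin m → Fin M) → ℝ := fun x y =>
    2 ^ m * φ (fun i => x i (fun j => y j i)) with hF
  have e1 : 𝔼 x : Fin m → (Fin 1 → Fin M) → Bool, 𝔼 y : Fin 1 → Fin m → Fin M,
      (2 ^ m * φ (fun i => x i (fun j => y j i))) * (g y * ∏ j, G j x y) =
      𝔼 x, G 0 x y0 * 𝔼 y, g y * F x y := by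
    refine Finset.expect_congr rfl fun x _ => ?_
    rw [Finset.mul_expect]
    refine Finset.expect_congr rfl fun y _ => ?_
    have : G 0 x y = G 0 x y0 := hG' _ _ _ _ fun j' hj => absurd (Subsingleton.elim _ _) hj
    rw [Fin.prod_univ_one, this, hF]
    ring
  have hcore : ∀ y y' : Fin 1 → Fin m → Fin M, |𝔼 x, (g y * F x y) * (g y' * F x y')| ≤
      (∏ i, (if y 0 i = y' 0 i then 8 * Real.exp 1 else 1)) * ((4 * Real.exp 1) ^ (d + 1))⁻¹ := by
    intro y y'
    have key := pt_core (E := Bool) d φ hφ1 hφ2 (fun i b => (fun j => if b then y j i else y' j i)) lam hlam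
    have e2 : ∀ x, (g y * F x y) * (g y' * F x y') = (g y * g y') *
        ∏ e : Bool, (2 ^ m * φ (fun i => x i (fun j => if e then y j i else y' j i))) := by
      intro x
      simp [hF]
      ring
    simp_rw [e2, ← Finset.mul_expect]
    rw [abs_mul]
    have hgg : |g y * g y'| ≤ 1 := by
      rw [abs_mul]; exact mul_le_one₀ (hg _) (abs_nonneg _) (hg _)
    refine (mul_le_of_le_one_left (abs_nonneg _) hgg).trans (key.trans ?_)
    rw [Fintype.card_bool, pow_mul, hL]
    refine mul_le_mul_of_nonneg_right ?_ (by positivity)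
    refine Finset.prod_le_prod (fun _ _ => by positivity) fun i _ => ?_
    split_ifs with h
    · have a1 : (2:ℝ) ^ (2 - (univ.image (fun (b : Bool) => (fun j : Fin 1 => if b then y j i else y' j i))).card) ≤ 2 ^ 1 := by
        refine pow_le_pow_right₀ (by norm_num) ?_
        have : 0 < (univ.image (fun (b : Bool) => (fun j : Fin 1 => if b then y j i else y' j i))).card :=
          Finset.card_pos.2 (Finset.univ_nonempty.image _)
        omega
      have a2 : lam ^ (ptT (fun (b : Bool) => (fun j : Fin 1 => if b then y j i else y' j i))).card ≤ lam ^ 2 := by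
        refine pow_le_pow_right₀ hlam ?_
        exact (Finset.card_le_univ _).trans (by simp)
      calc _ ≤ (2:ℝ) ^ 1 * lam ^ 2 := mul_le_mul a1 a2 (by positivity) (by norm_num)
        _ = _ := by rw [hL]; ring
    · have inj : Function.Injective (fun (b : Bool) => (fun j : Fin 1 => if b then y j i else y' j i)) := by
        intro b b' hb
        have := congrFun hb 0
        cases b <;> cases b' <;> simp at this ⊢
        · exact h this.symm
        · exact h this
      have a1 : (univ.image (fun (b : Bool) => (fun j : Fin 1 => if b then y j i else y' j i))).card = 2 := by
        rw [Finset.card_image_of_injective _ inj]; simp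
      have a2 : (ptT (fun (b : Bool) => (fun j : Fin 1 => if b then y j i else y' j i))) = ∅ := by
        refine Finset.eq_empty_of_forall_notMem fun b hb0 => ?_
        obtain ⟨b', hb, hb'⟩ := pt_mem_ptT _ _ hb0
        exact hb (inj hb')
      rw [a1, a2]; simp
  have hsq : (𝔼 x, G 0 x y0 * 𝔼 y, g y * F x y) ^ 2 ≤
      (1 + 8 * Real.exp 1 / M) ^ m * ((4 * Real.exp 1) ^ (d + 1))⁻¹ := by
    refine (pt_cs _ _ fun x => hG 0 x y0).trans ?_
    simp_rw [pt_sq]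
    rw [Finset.expect_comm]
    have s1 : ∀ y : Fin 1 → Fin m → Fin M, 𝔼 x, 𝔼 y', (g y * F x y) * (g y' * F x y') ≤
        (1 + 8 * Real.exp 1 / M) ^ m * ((4 * Real.exp 1) ^ (d + 1))⁻¹ := by
      intro y
      rw [Finset.expect_comm]
      refine (Finset.expect_le_expect fun y' _ => (le_abs_self _).trans (hcore y y')).trans ?_
      rw [← Finset.expect_mul]
      refine mul_le_mul_of_nonneg_right ?_ (by positivity)
      rw [pt_cons]
      simp only [Fin.cons_zero]
      simp_rw [Fintype.expect_const]
      rw [pt_pi (fun i (c : Fin M) => if y 0 i = c then 8 * Real.exp 1 else 1)]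
      have : ∀ i, 𝔼 c, (if y 0 i = c then 8 * Real.exp 1 else 1) ≤ (1 + 8 * Real.exp 1 / M) := by
        intro i
        have e : ∀ c, (if y 0 i = c then 8 * Real.exp 1 else 1) ≤ 1 + (if y 0 i = c then 8 * Real.exp 1 else 0) := by
          intro c; split_ifs <;> linarith
        refine (Finset.expect_le_expect fun c _ => e c).trans (le_of_eq ?_)
        rw [Finset.expect_add_distrib]
        rw [Fintype.expect_eq_sum_div_card (fun c => if y 0 i = c then 8 * Real.exp 1 else 0)]
        simp
      refine (Finset.prod_le_prod (fun i _ => Finset.expect_nonneg fun c _ => ?_) fun i _ => this i).trans ?_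
      · split_ifs <;> positivity
      · simp
    refine (Finset.expect_le_expect fun y _ => s1 y).trans ?_
    rw [Fintype.expect_const]
  rw [e1]
  have hfin : (1 + 8 * Real.exp 1 / M) ^ m * ((4 * Real.exp 1) ^ (d + 1))⁻¹ ≤ ((1/2 : ℝ) ^ d) ^ 2 := by
    have b1 : (1 + 8 * Real.exp 1 / M) ^ m ≤ Real.exp 1 ^ d := by
      calc _ ≤ Real.exp (8 * Real.exp 1 / M) ^ m := by
            refine pow_le_pow_left₀ (by positivity) ?_ m
            have := Real.add_one_le_exp (8 * Real.exp 1 / M)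
            linarith
        _ = Real.exp (m * (8 * Real.exp 1 / M)) := (Real.exp_nat_mul _ _).symm
        _ ≤ Real.exp (d * 1) := Real.exp_le_exp.2 (by linarith)
        _ = _ := Real.exp_nat_mul _ _
    have b2 : Real.exp 1 ^ d ≤ ((1/2 : ℝ) ^ d) ^ 2 * (4 * Real.exp 1) ^ (d + 1) := by
      have : ((1/2 : ℝ) ^ d) ^ 2 * (4 * Real.exp 1) ^ (d + 1) = Real.exp 1 ^ d * (4 * Real.exp 1) := by
        have h14 : ((1/2 : ℝ) ^ d) ^ 2 = (1/4) ^ d := by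
          rw [← pow_mul, mul_comm d 2, pow_mul]; norm_num
        rw [h14, pow_succ (4 * Real.exp 1) d, ← mul_assoc, ← mul_pow]
        congr 2
        ring
      rw [this]
      refine le_mul_of_one_le_right (by positivity) ?_
      have he := Real.exp_one_gt_d9
      linarith
    rw [← div_eq_mul_inv, div_le_iff₀ (by positivity)]
    exact b1.trans b2
  exact abs_le_of_sq_le_sq (hsq.trans hfin) (by positivity)

end final

/-- Let `φ : {-1,1}^m → ℝ` with `‖φ‖₁ = 1` whose Fourier coefficients vanish on all sets of
size at most `d`. If `M ≥ 2e(k−1)2^{2^{k−1}}m/d`, then the `(k,M)`-pattern tensor `A` of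
`c·φ`, where `c = 2^m/size(A)`, satisfies `μ*(A) ≤ 2^{−d}`. -/
theorem stmt17 (k m M d : ℕ) (hk : 2 ≤ k) (φ : (Fin m → Bool) → ℝ)
    (hφ1 : (∑ z, |φ z|) = 1)
    (hφ2 : ∀ T : Finset (Fin m), T.card ≤ d →
      ∑ z, φ z * ∏ i ∈ T, (if z i then 1 else -1 : ℝ) = 0)
    (hM : 2 * Real.exp 1 * ((k : ℝ) - 1) * 2 ^ (2 ^ (k - 1)) * (m : ℝ) / (d : ℝ) ≤ (M : ℝ)) :
    mustarP (fun p : PatIdx (k - 1) m M =>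
        ((2 : ℝ) ^ m / (Fintype.card (PatIdx (k - 1) m M) : ℝ)) * pattP φ p)
      ≤ (2 : ℝ) ^ (-(d : ℤ)) := by
  have hpos : (0:ℝ) ≤ (2 : ℝ) ^ (-(d : ℤ)) := by positivity
  have h2d : (2 : ℝ) ^ (-(d : ℤ)) = (1/2) ^ d := by
    rw [zpow_neg, zpow_natCast]; simp
  refine Real.sSup_le ?_ hpos
  rintro r ⟨Z, hZ, rfl⟩
  rw [pt_sum_eq, h2d]
  obtain ⟨g, G, hg, hG, hG', hgG⟩ := pt_cylfun Z hZ
  rcases Nat.eq_zero_or_pos d with hd0 | hd0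
  · subst hd0
    rw [pow_zero]
    refine pt_trivial φ hφ1 (fun x y => Z.indicator 1 (x, y)) fun x y => ?_
    by_cases h : (x, y) ∈ Z <;> simp [h]
  have hdm := pt_lt d φ hφ1 hφ2
  simp_rw [hgG]
  have hdR : (0:ℝ) < d := by exact_mod_cast hd0
  have hdmR : (d:ℝ) < m := by exact_mod_cast hdm
  have hmR : (0:ℝ) < m := hdR.trans hdmR
  have he := Real.exp_one_gt_d9
  have hk1 : (1:ℝ) ≤ (k:ℝ) - 1 := by
    have : (2:ℝ) ≤ k := by exact_mod_cast hk
    linarith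
  have hMR : (0:ℝ) < M := by
    refine lt_of_lt_of_le ?_ hM
    positivity
  have hM0 : 0 < M := by exact_mod_cast hMR
  rw [div_le_iff₀ hdR] at hM
  obtain ⟨n, rfl⟩ | rfl : (∃ n, k = n + 3) ∨ k = 2 := by
    rcases Nat.lt_or_ge k 3 with h | h
    · right; omega
    · left; exact ⟨k - 3, by omega⟩
  · have hA : (2:ℝ) ^ (2 ^ (n + 3 - 1)) = ((2:ℝ) ^ (2 ^ n)) ^ 4 := by
      rw [← pow_mul, show n + 3 - 1 = n + 2 from rfl, pow_add 2 n 2]; norm_num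
    rw [hA] at hM
    have hAp : (0:ℝ) < ((2:ℝ) ^ (2 ^ n)) ^ 4 := by positivity
    have hn : (2:ℝ) ≤ ((n + 3 : ℕ) : ℝ) - 1 := by push_cast; linarith [(Nat.cast_nonneg n : (0:ℝ) ≤ n)]
    have hM2 : 4 * Real.exp 1 * (((2:ℝ) ^ (2 ^ n)) ^ 4 * m) ≤ M * d := by
      refine le_trans ?_ hM
      calc 4 * Real.exp 1 * (((2:ℝ) ^ (2 ^ n)) ^ 4 * m) = 2 * Real.exp 1 * 2 * ((2:ℝ) ^ (2 ^ n)) ^ 4 * m := by ring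
        _ ≤ _ := by gcongr
    have hbig : 4 * Real.exp 1 * (m * (((2:ℝ) ^ (2 ^ n)) ^ 4 / M)) ≤ d := by
      have : 4 * Real.exp 1 * (m * (((2:ℝ) ^ (2 ^ n)) ^ 4 / M)) =
        4 * Real.exp 1 * (((2:ℝ) ^ (2 ^ n)) ^ 4 * m) / M := by ring
      rw [this, div_le_iff₀ hMR]
      linarith
    refine pt_main_big (n := n) d hM0 φ hφ1 hφ2 ?_ hbig g G hg hG hG'
    set δ := ((2:ℝ) ^ (2 ^ n)) ^ 4 / M with hδ
    have hδ0 : 0 ≤ δ := by positivity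
    have h3 : 4 * Real.exp 1 * (m * δ) ≤ m * 1 := by linarith
    have h4 : 4 * Real.exp 1 * δ ≤ 1 := by
      refine le_of_mul_le_mul_left ?_ hmR
      linarith
    nlinarith
  · refine pt_small d hM0 φ hφ1 hφ2 ?_ g G hg hG hG'
    have : (m:ℝ) * (8 * Real.exp 1 / M) = m * (8 * Real.exp 1) / M := by ring
    rw [this, div_le_iff₀ hMR]
    norm_num at hM
    linarith
end

section
/- Let f be a Boolean function on m variables with α₀-approximate degree d = deg_{α₀}(f), and suppose M ≥ 2e(k−1)2^{2^{k−1}}m/d. Then for every 1 ≤ α < α₀ < ∞, log₂ μ^α(A_{k,M,f}) ≥ d/2^{k−1} + log₂((α₀−α)/(α₀+1)). -/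
open scoped BigOperators

/-- The cylinder intersection norm `μ(B) = min { Σ|α_i| : B = Σ α_i χ(Z_i) }`. -/
noncomputable def muP {k1 m M : ℕ} (B : PatIdx k1 m M → ℝ) : ℝ :=
  sInf {s : ℝ | ∃ (n : ℕ) (α : Fin n → ℝ) (Z : Fin n → Set (PatIdx k1 m M)),
    (∀ t, IsCylIntP k1 m M (Z t)) ∧
    (∀ p, B p = ∑ t, α t * (Z t).indicator 1 p) ∧ s = ∑ t, |α t|}

/-- `μ^α(A) = min { μ(B) : 1 ≤ A∘B ≤ α }`. -/
noncomputable def muAlphaP {k1 m M : ℕ} (A : PatIdx k1 m M → ℝ) (α : ℝ) : ℝ :=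
  sInf {s : ℝ | ∃ B : PatIdx k1 m M → ℝ,
    (∀ p, 1 ≤ A p * B p ∧ A p * B p ≤ α) ∧ s = muP B}

/-- The set of degrees `e` such that some polynomial of degree at most `e` gives an
`α₀`-approximation of `f`; `deg_{α₀}(f)` is its least element. -/
def ApproxDegSet (m : ℕ) (f : (Fin m → Bool) → ℝ) (α₀ : ℝ) : Set ℕ :=
  {e : ℕ | ∃ c : Finset (Fin m) → ℝ, (∀ T, e < T.card → c T = 0) ∧
    ∀ z, 1 ≤ f z * (∑ T : Finset (Fin m), c T * ∏ i ∈ T, (if z i then 1 else -1 : ℝ)) ∧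
      f z * (∑ T : Finset (Fin m), c T * ∏ i ∈ T, (if z i then 1 else -1 : ℝ)) ≤ α₀}


/-- pick coordinates of a pair vector -/
def pick {n : ℕ} {Y : Type} (u : Fin n → Y × Y) (l : Fin n → Bool) : Fin n → Y :=
  fun j => if l j then (u j).2 else (u j).1

theorem sum_cons {n : ℕ} {Y : Type} [Fintype Y] (g : (Fin (n+1) → Y) → ℝ) :
    ∑ y, g y = ∑ a : Y, ∑ y : Fin n → Y, g (Fin.cons a y) := by
  rw [← Fintype.sum_prod_type']
  exact (Equiv.sum_comp (Fin.consEquiv (fun _ : Fin (n+1) => Y)) g).symm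

theorem prod_consB {n : ℕ} (g : (Fin (n+1) → Bool) → ℝ) :
    ∏ y, g y = ∏ y : Fin n → Bool, (g (Fin.cons false y) * g (Fin.cons true y)) := by
  rw [← Equiv.prod_comp (Fin.consEquiv (fun _ : Fin (n+1) => Bool)) g, Fintype.prod_prod_type,
    Fintype.prod_bool, mul_comm, ← Finset.prod_mul_distrib]
  rfl

theorem pick_cons {n : ℕ} {Y : Type} (a : Y × Y) (u : Fin n → Y × Y) (b : Bool)
    (l : Fin n → Bool) :
    pick (Fin.cons a u : Fin (n+1) → Y × Y) (Fin.cons b l) =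
      Fin.cons (if b then a.2 else a.1) (pick u l) := by
  funext j
  refine Fin.cases ?_ (fun i => ?_) j <;> simp [pick]

theorem bns (Y : Type) [Fintype Y] [Nonempty Y] (n : ℕ) :
    ∀ (X : Type) [Fintype X] [Nonempty X] (H : X → (Fin n → Y) → ℝ)
      (χ : Fin n → X → (Fin n → Y) → ℝ)
      (_ : ∀ j x y, |χ j x y| ≤ 1)
      (_ : ∀ j x y y', (∀ j', j' ≠ j → y j' = y' j') → χ j x y = χ j x y'),
      ((∑ x, ∑ y, H x y * ∏ j, χ j x y) / (Fintype.card X * (Fintype.card Y : ℝ) ^ n)) ^ (2 ^ n) ≤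
      (∑ x, ∑ u : Fin n → Y × Y, ∏ l, H x (pick u l)) /
        (Fintype.card X * (Fintype.card Y : ℝ) ^ (2 * n)) := by
  induction n with
  | zero =>
    intro X _ _ H χ h1 h2
    apply le_of_eq
    simp
    congr 1
    funext x
    exact congrArg (H x) (Subsingleton.elim _ _)
  | succ n ih =>
    intro X _ _ H χ h1 h2
    obtain ⟨y₀⟩ : Nonempty Y := inferInstance
    have key := ih (X × (Y × Y)) (fun p y => H p.1 (Fin.cons p.2.1 y) * H p.1 (Fin.cons p.2.2 y))
      (fun j p y => χ j.succ p.1 (Fin.cons p.2.1 y) * χ j.succ p.1 (Fin.cons p.2.2 y))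
      (by
        intro j p y
        rw [abs_mul]
        exact mul_le_one₀ (h1 _ _ _) (abs_nonneg _) (h1 _ _ _))
      (by
        intro j p y y' h
        have : ∀ a : Y, χ j.succ p.1 (Fin.cons a y) = χ j.succ p.1 (Fin.cons a y') := by
          intro a
          apply h2
          intro j'
          refine Fin.cases ?_ (fun i => ?_) j'
          · simp
          · intro hi
            simp only [Fin.cons_succ]
            exact h i (fun e => hi (by rw [e]))
        simp only [this])
    have hX : (0 : ℝ) < Fintype.card X := by exact_mod_cast Fintype.card_pos
    have hY : (0 : ℝ) < Fintype.card Y := by exact_mod_cast Fintype.card_pos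
    -- the square step
    set R : X → (Fin n → Y) → Y → ℝ := fun x y a =>
      H x (Fin.cons a y) * ∏ j : Fin n, χ j.succ x (Fin.cons a y) with hR
    set S : ℝ := ∑ x, ∑ y, H x y * ∏ j, χ j x y with hS
    have hS1 : S = ∑ p : X × (Fin n → Y), χ 0 p.1 (Fin.cons y₀ p.2) * ∑ a, R p.1 p.2 a := by
      rw [hS, Fintype.sum_prod_type]
      apply Finset.sum_congr rfl
      intro x _
      rw [sum_cons, Finset.sum_comm]
      apply Finset.sum_congr rfl
      intro y _
      rw [Finset.mul_sum]
      apply Finset.sum_congr rfl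
      intro a _
      rw [Fin.prod_univ_succ, h2 0 x (Fin.cons a y) (Fin.cons y₀ y)]
      · simp only [hR]; ring
      · intro j'
        refine Fin.cases ?_ (fun i => ?_) j' <;> simp
    set S' : ℝ := ∑ p : X × (Y × Y), ∑ y : Fin n → Y,
      (H p.1 (Fin.cons p.2.1 y) * H p.1 (Fin.cons p.2.2 y)) *
        ∏ j : Fin n, (χ j.succ p.1 (Fin.cons p.2.1 y) * χ j.succ p.1 (Fin.cons p.2.2 y)) with hS'
    have hS2 : ∑ p : X × (Fin n → Y), (∑ a, R p.1 p.2 a) ^ 2 = S' := by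
      rw [hS', Fintype.sum_prod_type, Fintype.sum_prod_type]
      apply Finset.sum_congr rfl
      intro x _
      rw [Finset.sum_comm (s := (Finset.univ : Finset (Y × Y)))]
      apply Finset.sum_congr rfl
      intro y _
      rw [sq, Finset.sum_mul_sum, Fintype.sum_prod_type]
      apply Finset.sum_congr rfl
      intro a _
      apply Finset.sum_congr rfl
      intro b _
      rw [Finset.prod_mul_distrib]
      simp only [hR]; ring
    have hsq : S ^ 2 ≤ (Fintype.card X * (Fintype.card Y : ℝ) ^ n) * S' := by
      rw [hS1, ← hS2]
      refine (Finset.sum_mul_sq_le_sq_mul_sq _ _ _).trans ?_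
      apply mul_le_mul_of_nonneg_right _ (Finset.sum_nonneg fun _ _ => sq_nonneg _)
      calc _ ≤ ∑ p : X × (Fin n → Y), (1 : ℝ) := by
            apply Finset.sum_le_sum
            intro p _
            exact (sq_le_one_iff_abs_le_one _).2 (h1 _ _ _)
        _ = _ := by simp
    have hdiv : (S / (Fintype.card X * (Fintype.card Y : ℝ) ^ (n + 1))) ^ 2 ≤
        S' / (Fintype.card (X × (Y × Y)) * (Fintype.card Y : ℝ) ^ n) := by
      rw [div_pow, div_le_div_iff₀ (by positivity)
        (by rw [Fintype.card_prod, Fintype.card_prod]; push_cast; positivity)]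
      rw [Fintype.card_prod, Fintype.card_prod]
      push_cast
      calc _ ≤ ((Fintype.card X * (Fintype.card Y : ℝ) ^ n) * S') *
            (Fintype.card X * ((Fintype.card Y : ℝ) * Fintype.card Y) * (Fintype.card Y : ℝ) ^ n) :=
            mul_le_mul_of_nonneg_right hsq (by positivity)
        _ = _ := by ring
    rw [pow_succ' 2 n, pow_mul]
    refine (pow_le_pow_left₀ (sq_nonneg _) hdiv _).trans (key.trans (le_of_eq ?_))
    congr 1
    · rw [Fintype.sum_prod_type]
      apply Finset.sum_congr rfl
      intro x _
      rw [sum_cons]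
      apply Finset.sum_congr rfl
      intro a _
      apply Finset.sum_congr rfl
      intro u _
      rw [prod_consB]
      apply Finset.prod_congr rfl
      intro l _
      rw [pick_cons, pick_cons]
      simp
    · rw [Fintype.card_prod, Fintype.card_prod]
      push_cast
      ring

/-- sign -/
noncomputable def sg (b : Bool) : ℝ := if b then 1 else -1

theorem sum_xor_b {m : ℕ} (q : (Fin m → Bool) → ℝ) (S : Finset (Fin m)) (z : Fin m → Bool) :
    ∑ b : Fin m → Bool, q (fun i => xor (z i) (if i ∈ S then false else b i)) =
      ∑ w, q w * ∏ i ∈ S, (1 + sg (z i) * sg (w i)) := by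
  classical
  have h : ∀ w : Fin m → Bool, ∏ i ∈ S, (1 + sg (z i) * sg (w i)) =
      ∑ b : Fin m → Bool, if w = (fun i => xor (z i) (if i ∈ S then false else b i))
        then (1:ℝ) else 0 := by
    intro w
    have e1 : ∀ b : Fin m → Bool,
        (if w = (fun i => xor (z i) (if i ∈ S then false else b i)) then (1:ℝ) else 0) =
        ∏ i, (if w i = xor (z i) (if i ∈ S then false else b i) then (1:ℝ) else 0) := by
      intro b
      rw [Finset.prod_ite_zero]
      simp [funext_iff]
    simp only [e1]
    rw [← Fintype.prod_sum (f := fun i (β : Bool) =>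
      (if w i = xor (z i) (if i ∈ S then false else β) then (1:ℝ) else 0))]
    rw [← Finset.prod_subset (Finset.subset_univ S)]
    · apply Finset.prod_congr rfl
      intro i hi
      simp only [hi, if_true, Fintype.sum_bool, sg]
      cases z i <;> cases w i <;> norm_num
    · intro i _ hi
      simp only [hi, if_false, Fintype.sum_bool]
      cases z i <;> cases w i <;> norm_num
  simp only [h, Finset.mul_sum]
  rw [Finset.sum_comm]
  simp

theorem sum_xor_zero {m d : ℕ} (q : (Fin m → Bool) → ℝ)
    (hq : ∀ T : Finset (Fin m), T.card < d → ∑ w, q w * ∏ i ∈ T, sg (w i) = 0)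
    (S : Finset (Fin m)) (hS : S.card < d) (z : Fin m → Bool) :
    ∑ b : Fin m → Bool, q (fun i => xor (z i) (if i ∈ S then false else b i)) = 0 := by
  rw [sum_xor_b]
  simp only [Finset.prod_one_add, Finset.mul_sum]
  rw [Finset.sum_comm]
  apply Finset.sum_eq_zero
  intro T hT
  have := hq T (lt_of_le_of_lt (Finset.card_le_card (Finset.mem_powerset.1 hT)) hS)
  calc _ = (∏ i ∈ T, sg (z i)) * ∑ w, q w * ∏ i ∈ T, sg (w i) := by
        rw [Finset.mul_sum]
        apply Finset.sum_congr rfl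
        intro w _
        rw [Finset.prod_mul_distrib]; ring
    _ = 0 := by rw [this, mul_zero]

theorem sum_xor_le {m : ℕ} (q : (Fin m → Bool) → ℝ) (hq1 : ∑ w, |q w| = 1)
    (S : Finset (Fin m)) (z : Fin m → Bool) :
    |∑ b : Fin m → Bool, q (fun i => xor (z i) (if i ∈ S then false else b i))| ≤ 2 ^ S.card := by
  rw [sum_xor_b]
  refine (Finset.abs_sum_le_sum_abs _ _).trans ?_
  calc _ ≤ ∑ w, |q w| * 2 ^ S.card := by
        apply Finset.sum_le_sum
        intro w _
        rw [abs_mul, Finset.abs_prod]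
        apply mul_le_mul_of_nonneg_left _ (abs_nonneg _)
        rw [← Finset.prod_const]
        apply Finset.prod_le_prod
        · intros; positivity
        · intro i _
          simp only [sg]
          cases z i <;> cases w i <;> norm_num
    _ = _ := by rw [← Finset.sum_mul, hq1, one_mul]

/-- bad blocks -/
def badS {n m M : ℕ} (u : Fin n → (Fin m → Fin M) × (Fin m → Fin M)) : Finset (Fin m) :=
  Finset.univ.filter fun i => ∃ j, (u j).1 i = (u j).2 i

theorem sum_shift {m : ℕ} {P : Type} [Fintype P] [DecidableEq P] (c : Fin m → P → Bool)
    (h : (Fin m → P → Bool) → ℝ) :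
    ∑ x : Fin m → P → Bool, h (fun i p => xor (x i p) (c i p)) = ∑ x, h x := by
  have hi : Function.Involutive
      (fun (x : Fin m → P → Bool) => (fun i p => xor (x i p) (c i p))) := by
    intro x; funext i p; simp
  exact Equiv.sum_comp hi.toPerm h

theorem block_id {n m M : ℕ} (q : (Fin m → Bool) → ℝ)
    (u : Fin n → (Fin m → Fin M) × (Fin m → Fin M)) :
    (2 ^ (m * 2 ^ n) : ℝ) * ∑ x : Fin m → (Fin n → Fin M) → Bool,
        ∏ l : Fin n → Bool, q (fun i => x i (fun j => pick u l j i)) =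
      ∑ x : Fin m → (Fin n → Fin M) → Bool, ∏ l : Fin n → Bool,
        ∑ b : Fin m → Bool, q (fun i => xor (x i (fun j => pick u l j i))
          (if i ∈ badS u then false else b i)) := by
  classical
  let c : ((Fin n → Bool) → Fin m → Bool) → Fin m → (Fin n → Fin M) → Bool := fun b i P =>
    if i ∈ badS u then false else
      Function.extend (fun (l : Fin n → Bool) (j : Fin n) => pick u l j i) (fun l => b l i)
        (fun _ => false) P
  have hc : ∀ b i l, c b i (fun j => pick u l j i) = if i ∈ badS u then false else b l i := by
    intro b i l
    by_cases hi : i ∈ badS u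
    · simp [c, hi]
    · simp only [c, hi, if_false]
      have hinj : Function.Injective
          (fun (l : Fin n → Bool) (j : Fin n) => pick u l j i) := by
        intro l l' hl
        funext j
        have h1 := congrFun hl j
        have h2 : (u j).1 i ≠ (u j).2 i := by
          intro h; apply hi; simp only [badS, Finset.mem_filter, Finset.mem_univ, true_and]
          exact ⟨j, h⟩
        simp only [pick] at h1
        cases hlj : l j <;> cases hlj' : l' j <;> simp_all
      exact hinj.extend_apply (fun l => b l i) _ l
  have step : ∀ b : (Fin n → Bool) → Fin m → Bool,
      ∑ x : Fin m → (Fin n → Fin M) → Bool,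
        ∏ l : Fin n → Bool, q (fun i => x i (fun j => pick u l j i)) =
      ∑ x : Fin m → (Fin n → Fin M) → Bool,
        ∏ l : Fin n → Bool, q (fun i => xor (x i (fun j => pick u l j i))
          (if i ∈ badS u then false else b l i)) := by
    intro b
    rw [← sum_shift (c b)]
    simp only [hc]
  have hcard : (2 ^ (m * 2 ^ n) : ℝ) = ∑ b : (Fin n → Bool) → Fin m → Bool, (1 : ℝ) := by
    simp [pow_mul]
  rw [hcard, Finset.sum_mul]
  simp only [one_mul]
  rw [Finset.sum_congr rfl (fun b _ => step b), Finset.sum_comm]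
  apply Finset.sum_congr rfl
  intro x _
  rw [Fintype.prod_sum]

theorem equidist {n m M : ℕ} (ψ : (Fin m → Bool) → ℝ) (y : Fin n → Fin m → Fin M) :
    (2 : ℝ) ^ m * ∑ x : Fin m → (Fin n → Fin M) → Bool, ψ (fun i => x i (fun j => y j i)) =
      Fintype.card (Fin m → (Fin n → Fin M) → Bool) * ∑ z, ψ z := by
  have step : ∀ b : Fin m → Bool,
      ∑ x : Fin m → (Fin n → Fin M) → Bool, ψ (fun i => x i (fun j => y j i)) =
      ∑ x : Fin m → (Fin n → Fin M) → Bool, ψ (fun i => xor (x i (fun j => y j i)) (b i)) := by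
    intro b
    rw [← sum_shift (fun i _ => b i)]
  have hcard : (2 ^ m : ℝ) = ∑ b : Fin m → Bool, (1 : ℝ) := by
    simp
  rw [hcard, Finset.sum_mul]
  simp only [one_mul]
  rw [Finset.sum_congr rfl (fun b _ => step b), Finset.sum_comm]
  have : ∀ x : Fin m → (Fin n → Fin M) → Bool,
      ∑ b : Fin m → Bool, ψ (fun i => xor (x i (fun j => y j i)) (b i)) = ∑ z, ψ z := by
    intro x
    have hi : Function.Involutive
      (fun (b : Fin m → Bool) => (fun i => xor (x i (fun j => y j i)) (b i))) := by
      intro b; funext i; simp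
    exact Equiv.sum_comp hi.toPerm ψ
  simp only [this, Finset.sum_const, nsmul_eq_mul, Finset.card_univ]

theorem block_bound {n m M d : ℕ} (q : (Fin m → Bool) → ℝ) (hq1 : ∑ w, |q w| = 1)
    (hq : ∀ T : Finset (Fin m), T.card < d → ∑ w, q w * ∏ i ∈ T, sg (w i) = 0)
    (u : Fin n → (Fin m → Fin M) × (Fin m → Fin M)) (t : ℝ) (ht : 1 ≤ t) :
    (2 ^ (m * 2 ^ n) : ℝ) * |∑ x : Fin m → (Fin n → Fin M) → Bool,
        ∏ l : Fin n → Bool, q (fun i => x i (fun j => pick u l j i))| * t ^ d ≤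
      Fintype.card (Fin m → (Fin n → Fin M) → Bool) * (2 ^ (2 ^ n) * t) ^ (badS u).card := by
  have e : (2 ^ (m * 2 ^ n) : ℝ) * |∑ x : Fin m → (Fin n → Fin M) → Bool,
        ∏ l : Fin n → Bool, q (fun i => x i (fun j => pick u l j i))| =
      |∑ x : Fin m → (Fin n → Fin M) → Bool, ∏ l : Fin n → Bool,
        ∑ b : Fin m → Bool, q (fun i => xor (x i (fun j => pick u l j i))
          (if i ∈ badS u then false else b i))| := by
    rw [← block_id, abs_mul, abs_of_pos (a := (2 ^ (m * 2 ^ n) : ℝ)) (by positivity)]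
  rw [e]
  have ht0 : 0 ≤ t := by linarith
  by_cases hS : (badS u).card < d
  · have : ∀ x : Fin m → (Fin n → Fin M) → Bool, ∏ l : Fin n → Bool,
        ∑ b : Fin m → Bool, q (fun i => xor (x i (fun j => pick u l j i))
          (if i ∈ badS u then false else b i)) = 0 := by
      intro x
      exact Finset.prod_eq_zero (Finset.mem_univ (fun _ => false)) (sum_xor_zero q hq _ hS _)
    simp only [this, Finset.sum_const_zero, abs_zero, zero_mul]
    positivity
  · push Not at hS
    have h1 : |∑ x : Fin m → (Fin n → Fin M) → Bool, ∏ l : Fin n → Bool,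
        ∑ b : Fin m → Bool, q (fun i => xor (x i (fun j => pick u l j i))
          (if i ∈ badS u then false else b i))| ≤
        ∑ x : Fin m → (Fin n → Fin M) → Bool, ((2:ℝ) ^ (badS u).card) ^ (2 ^ n) := by
      refine (Finset.abs_sum_le_sum_abs _ _).trans (Finset.sum_le_sum fun x _ => ?_)
      rw [Finset.abs_prod]
      refine (Finset.prod_le_prod (fun _ _ => abs_nonneg _)
        (fun l _ => sum_xor_le q hq1 _ _)).trans (le_of_eq ?_)
      simp
    rw [Finset.sum_const, nsmul_eq_mul, Finset.card_univ] at h1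
    refine (mul_le_mul h1 (pow_le_pow_right₀ ht hS) (by positivity) (by positivity)).trans
      (le_of_eq ?_)
    rw [mul_pow, ← pow_mul, ← pow_mul, mul_comm (2 ^ n) (badS u).card, mul_assoc]

/-- transpose pair vectors -/
def trE (n m M : ℕ) : (Fin m → Fin n → Fin M × Fin M) ≃
    (Fin n → (Fin m → Fin M) × (Fin m → Fin M)) where
  toFun v := fun j => (fun i => (v i j).1, fun i => (v i j).2)
  invFun u := fun i j => ((u j).1 i, (u j).2 i)
  left_inv _ := rfl
  right_inv _ := rfl

theorem one_block {n M : ℕ} (c : ℝ) (hc : 0 ≤ c) (hM : 0 < M) :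
    ∑ v : Fin n → Fin M × Fin M, (if ∃ j, (v j).1 = (v j).2 then c else 1) ≤
      (M : ℝ) ^ (2 * n) * (1 + c * n / M) := by
  classical
  have hMr : (0:ℝ) < M := by exact_mod_cast hM
  have h1 : ∀ v : Fin n → Fin M × Fin M, (if ∃ j, (v j).1 = (v j).2 then c else 1) ≤
      1 + c * ∑ j, if (v j).1 = (v j).2 then (1:ℝ) else 0 := by
    intro v
    have hnn : ∀ j ∈ Finset.univ, (0:ℝ) ≤ if (v j).1 = (v j).2 then (1:ℝ) else 0 := by
      intro j _; split_ifs <;> norm_num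
    split_ifs with h
    · obtain ⟨j, hj⟩ := h
      have := Finset.single_le_sum hnn (Finset.mem_univ j)
      simp only [hj, if_true] at this
      nlinarith
    · have := Finset.sum_nonneg hnn
      have := mul_nonneg hc this
      linarith
  have h2 : ∀ j : Fin n, ∑ v : Fin n → Fin M × Fin M, (if (v j).1 = (v j).2 then (1:ℝ) else 0) =
      (M:ℝ) ^ (2 * n) / M := by
    intro j
    have e : ∀ v : Fin n → Fin M × Fin M, (if (v j).1 = (v j).2 then (1:ℝ) else 0) =
        ∏ j', (if j' = j then (if (v j').1 = (v j').2 then (1:ℝ) else 0) else 1) := by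
      intro v; simp
    simp only [e]
    rw [← Fintype.prod_sum (f := fun j' (a : Fin M × Fin M) =>
      (if j' = j then (if a.1 = a.2 then (1:ℝ) else 0) else 1))]
    have e2 : ∀ j' : Fin n, ∑ a : Fin M × Fin M,
        (if j' = j then (if a.1 = a.2 then (1:ℝ) else 0) else 1) =
        (M:ℝ)^2 * (if j' = j then (1/M:ℝ) else 1) := by
      intro j'
      split_ifs
      · rw [Fintype.sum_prod_type]; simp; field_simp
      · simp; ring
    simp only [e2, Finset.prod_mul_distrib]
    simp [pow_mul]
    rfl
  refine (Finset.sum_le_sum fun v _ => h1 v).trans (le_of_eq ?_)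
  rw [Finset.sum_add_distrib, ← Finset.mul_sum, Finset.sum_comm]
  simp only [h2]
  simp
  ring

theorem chernoff {n m M : ℕ} (c : ℝ) (hc : 0 ≤ c) (hM : 0 < M) :
    ∑ u : Fin n → (Fin m → Fin M) × (Fin m → Fin M), c ^ (badS u).card ≤
      (M : ℝ) ^ (2 * n * m) * Real.exp (c * n * m / M) := by
  classical
  have e1 : ∑ u : Fin n → (Fin m → Fin M) × (Fin m → Fin M), c ^ (badS u).card =
      ∑ v : Fin m → Fin n → Fin M × Fin M,
        ∏ i, (if ∃ j, (v i j).1 = (v i j).2 then c else 1) := by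
    rw [← Equiv.sum_comp (trE n m M)]
    apply Finset.sum_congr rfl
    intro v _
    rw [Finset.prod_ite]
    simp [badS, trE]
    congr!
  rw [e1, ← Fintype.prod_sum (f := fun (_ : Fin m) (v : Fin n → Fin M × Fin M) =>
    (if ∃ j, (v j).1 = (v j).2 then c else 1))]
  rw [Finset.prod_const, Finset.card_univ, Fintype.card_fin]
  have hle : ∑ v : Fin n → Fin M × Fin M, (if ∃ j, (v j).1 = (v j).2 then c else 1) ≤
      (M : ℝ) ^ (2 * n) * Real.exp (c * n / M) := by
    refine (one_block c hc hM).trans ?_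
    apply mul_le_mul_of_nonneg_left _ (by positivity)
    have := Real.add_one_le_exp (c * n / M)
    linarith
  refine (pow_le_pow_left₀ (Finset.sum_nonneg fun v _ => by split_ifs <;> linarith) hle m).trans
    (le_of_eq ?_)
  rw [mul_pow, ← pow_mul, ← Real.exp_nat_mul]
  congr 2
  ring

theorem cyl_bound {n m M d : ℕ} (hn : 1 ≤ n) (hM : 0 < M) (hd : 0 < d)
    (q : (Fin m → Bool) → ℝ) (hq1 : ∑ w, |q w| = 1)
    (hq : ∀ T : Finset (Fin m), T.card < d → ∑ w, q w * ∏ i ∈ T, sg (w i) = 0)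
    (hMd : 2 * Real.exp 1 * (n : ℝ) * 2 ^ (2 ^ n) * (m : ℝ) / (d : ℝ) ≤ (M : ℝ))
    (Z : Set (PatIdx n m M)) (hZ : IsCylIntP n m M Z) :
    |∑ p : PatIdx n m M, pattP q p * Z.indicator 1 p| ≤
      (Fintype.card (PatIdx n m M) : ℝ) * ((1 / 2 ^ m) * (2 : ℝ) ^ (-((d : ℝ) / 2 ^ n))) := by
  classical
  obtain ⟨Z0, ZY, h0, hY, rfl⟩ := hZ
  have : Nonempty (Fin M) := ⟨⟨0, hM⟩⟩
  have hMr : (0:ℝ) < M := by exact_mod_cast hM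
  have hdr : (0:ℝ) < d := by exact_mod_cast hd
  let X := Fin m → (Fin n → Fin M) → Bool
  let Y := Fin m → Fin M
  obtain ⟨x₀⟩ : Nonempty X := inferInstance
  let χ0 : (Fin n → Y) → ℝ := fun y => if (x₀, y) ∈ Z0 then 1 else 0
  let χ : Fin n → X → (Fin n → Y) → ℝ := fun j x y => if (x, y) ∈ ZY j then 1 else 0
  let Q : X → (Fin n → Y) → ℝ := fun x y => q (fun i => x i (fun j => y j i))
  let H : X → (Fin n → Y) → ℝ := fun x y => χ0 y * Q x y
  have hb := bns Y n X H χ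
    (by intro j x y; simp only [χ]; split_ifs <;> simp)
    (by
      intro j x y y' h
      have : (x, y) ∈ ZY j ↔ (x, y') ∈ ZY j :=
        ⟨hY j x y y' h, hY j x y' y (fun j' hj' => (h j' hj').symm)⟩
      simp only [χ, this])
  have hsum : ∑ p : PatIdx n m M, pattP q p * (Z0 ∩ ⋂ j, ZY j).indicator 1 p =
      ∑ x, ∑ y, H x y * ∏ j, χ j x y := by
    rw [Fintype.sum_prod_type]
    apply Finset.sum_congr rfl
    intro x _
    apply Finset.sum_congr rfl
    intro y _
    have e0 : (x₀, y) ∈ Z0 ↔ (x, y) ∈ Z0 := ⟨h0 _ _ _, h0 _ _ _⟩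
    simp only [H, χ0, χ, Q, pattP, e0, Finset.prod_ite_zero, Set.indicator_apply,
      Set.mem_inter_iff, Set.mem_iInter]
    by_cases h1 : (x, y) ∈ Z0 <;> by_cases h2 : ∀ j, (x, y) ∈ ZY j <;> simp [h1, h2]
  rw [hsum]
  set E : ℝ := (∑ x, ∑ y, H x y * ∏ j, χ j x y) /
    (Fintype.card X * (Fintype.card Y : ℝ) ^ n) with hE
  have hXpos : (0:ℝ) < Fintype.card X := by exact_mod_cast Fintype.card_pos
  have hYpos : (0:ℝ) < Fintype.card Y := by exact_mod_cast Fintype.card_pos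
  have hN : (Fintype.card (PatIdx n m M) : ℝ) = Fintype.card X * (Fintype.card Y : ℝ) ^ n := by
    rw [Fintype.card_prod, Fintype.card_fun (α := Fin n), Fintype.card_fin]
    push_cast
    rfl
  have hSE : ∑ x, ∑ y, H x y * ∏ j, χ j x y = (Fintype.card (PatIdx n m M) : ℝ) * E := by
    rw [hN, hE]; field_simp
  rw [hSE, abs_mul, abs_of_nonneg (Nat.cast_nonneg _)]
  apply mul_le_mul_of_nonneg_left _ (Nat.cast_nonneg _)
  -- bound on the box sum
  set t : ℝ := 2 * Real.exp 1 with ht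
  have ht1 : 1 ≤ t := by
    have := Real.add_one_le_exp (1:ℝ)
    rw [ht]; linarith
  have htpos : 0 < t := by linarith
  have hbox : (∑ x, ∑ u : Fin n → Y × Y, ∏ l, H x (pick u l)) ≤
      ∑ u : Fin n → Y × Y, |∑ x : X, ∏ l, Q x (pick u l)| := by
    rw [Finset.sum_comm]
    apply Finset.sum_le_sum
    intro u _
    have : ∑ x, ∏ l, H x (pick u l) = (∏ l, χ0 (pick u l)) * ∑ x, ∏ l, Q x (pick u l) := by
      rw [Finset.mul_sum]
      apply Finset.sum_congr rfl
      intro x _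
      rw [← Finset.prod_mul_distrib]
    rw [this]
    refine (le_abs_self _).trans ?_
    rw [abs_mul]
    apply mul_le_of_le_one_left (abs_nonneg _)
    rw [Finset.abs_prod]
    apply Finset.prod_le_one
    · intros; positivity
    · intro l _; simp only [χ0]; split_ifs <;> simp
  have hbox2 : (2 ^ (m * 2 ^ n) : ℝ) * t ^ d *
      (∑ u : Fin n → Y × Y, |∑ x : X, ∏ l, Q x (pick u l)|) ≤
      Fintype.card X * ((Fintype.card Y : ℝ) ^ (2 * n) * Real.exp d) := by
    have hc : (Fintype.card Y : ℝ) ^ (2 * n) = (M : ℝ) ^ (2 * n * m) := by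
      rw [Fintype.card_fun, Fintype.card_fin, Fintype.card_fin]
      push_cast
      rw [← pow_mul]; ring
    calc _ = ∑ u : Fin n → Y × Y, (2 ^ (m * 2 ^ n) : ℝ) *
            |∑ x : X, ∏ l, Q x (pick u l)| * t ^ d := by
          rw [Finset.mul_sum]
          apply Finset.sum_congr rfl
          intro u _; ring
      _ ≤ ∑ u : Fin n → Y × Y, Fintype.card X * (2 ^ (2 ^ n) * t) ^ (badS u).card :=
          Finset.sum_le_sum fun u _ => block_bound q hq1 hq u t ht1
      _ = Fintype.card X * ∑ u : Fin n → Y × Y, (2 ^ (2 ^ n) * t) ^ (badS u).card := by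
          rw [Finset.mul_sum]
      _ ≤ Fintype.card X * ((M : ℝ) ^ (2 * n * m) *
            Real.exp ((2 ^ (2 ^ n) * t) * n * m / M)) :=
          mul_le_mul_of_nonneg_left (chernoff _ (by positivity) hM) (by positivity)
      _ ≤ _ := by
          rw [hc]
          apply mul_le_mul_of_nonneg_left _ (by positivity)
          apply mul_le_mul_of_nonneg_left _ (by positivity)
          apply Real.exp_le_exp.2
          rw [div_le_iff₀ hMr]
          rw [div_le_iff₀ hdr] at hMd
          linarith
  have hfin : E ^ (2 ^ n) ≤ ((1 / 2 ^ m) * (2 : ℝ) ^ (-((d : ℝ) / 2 ^ n))) ^ (2 ^ n) := by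
    refine hb.trans ?_
    rw [div_le_iff₀ (by positivity)]
    refine hbox.trans ?_
    have e1 : ((1 / 2 ^ m) * (2 : ℝ) ^ (-((d : ℝ) / 2 ^ n))) ^ (2 ^ n) =
        1 / 2 ^ (m * 2 ^ n) * (1 / 2 ^ d) := by
      rw [mul_pow, ← Real.rpow_mul_natCast (by norm_num)]
      congr 1
      · rw [div_pow, one_pow, ← pow_mul]
      · have : -((d : ℝ) / 2 ^ n) * ((2 ^ n : ℕ) : ℝ) = -(d : ℝ) := by
          push_cast; field_simp
        rw [this, Real.rpow_neg (by norm_num), Real.rpow_natCast, one_div]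
    have e2 : Real.exp d = (Real.exp 1) ^ d := by
      rw [← Real.exp_nat_mul, mul_one]
    rw [e1]
    rw [e2, ht, mul_pow] at hbox2
    have hep : 0 < (Real.exp 1) ^ d := by positivity
    have h3 : (2 ^ (m * 2 ^ n) : ℝ) * 2 ^ d *
        (∑ u : Fin n → Y × Y, |∑ x : X, ∏ l, Q x (pick u l)|) ≤
        Fintype.card X * (Fintype.card Y : ℝ) ^ (2 * n) := by
      apply le_of_mul_le_mul_right _ hep
      linarith
    rw [one_div_mul_one_div, div_mul_eq_mul_div, one_mul, le_div_iff₀ (by positivity)]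
    linarith
  have hev : Even (2 ^ n) := (even_two).pow_of_ne_zero (by omega)
  rw [← hev.pow_abs] at hfin
  exact (pow_le_pow_iff_left₀ (abs_nonneg _) (by positivity) (by positivity)).1 hfin

theorem singleton_cyl {n m M : ℕ} (hn : 1 ≤ n) (p : PatIdx n m M) : IsCylIntP n m M {p} := by
  refine ⟨{p' | p'.2 = p.2}, fun j => {p' | p'.1 = p.1 ∧ ∀ j', j' ≠ j → p'.2 j' = p.2 j'},
    ?_, ?_, ?_⟩
  · intro x x' y h; exact h
  · intro j x y y' h h'
    exact ⟨h'.1, fun j' hj' => (h j' hj').symm.trans (h'.2 j' hj')⟩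
  · ext p'
    simp only [Set.mem_singleton_iff, Set.mem_inter_iff, Set.mem_ofPred_eq, Set.mem_iInter]
    constructor
    · rintro rfl; simp
    · rintro ⟨h1, h2⟩
      exact Prod.ext (h2 ⟨0, hn⟩).1 h1

theorem mu_lower {n m M : ℕ} (hn : 1 ≤ n) (A : PatIdx n m M → ℝ) (α c ε : ℝ)
    (hA : ∀ p, A p = 1 ∨ A p = -1) (hα : 1 ≤ α) (hε : 0 < ε)
    (Q : PatIdx n m M → ℝ)
    (hQ : ∀ Z, IsCylIntP n m M Z → |∑ p, Q p * Z.indicator 1 p| ≤ ε)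
    (hB : ∀ B : PatIdx n m M → ℝ, (∀ p, 1 ≤ A p * B p ∧ A p * B p ≤ α) → c ≤ ∑ p, Q p * B p) :
    c / ε ≤ muAlphaP A α := by
  classical
  apply le_csInf
  · refine ⟨_, A, ?_, rfl⟩
    intro p
    rcases hA p with h | h <;> rw [h] <;> constructor <;> linarith
  · rintro s ⟨B, hB1, rfl⟩
    apply le_csInf
    · let e := Fintype.equivFin (PatIdx n m M)
      refine ⟨_, Fintype.card (PatIdx n m M), fun t => B (e.symm t), fun t => {e.symm t},
        fun t => singleton_cyl hn _, ?_, rfl⟩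
      intro p
      rw [Equiv.sum_comp e.symm (fun p' => B p' * ({p'} : Set (PatIdx n m M)).indicator 1 p)]
      simp [Set.indicator_apply]
    · rintro s ⟨N, a, Z, hZ, hBe, rfl⟩
      rw [div_le_iff₀ hε]
      refine (hB B hB1).trans ?_
      calc ∑ p, Q p * B p = ∑ t, a t * ∑ p, Q p * (Z t).indicator 1 p := by
            simp only [hBe, Finset.mul_sum]
            rw [Finset.sum_comm]
            apply Finset.sum_congr rfl; intro t _
            apply Finset.sum_congr rfl; intro p _
            ring
        _ ≤ ∑ t, |a t| * ε := by
            apply Finset.sum_le_sum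
            intro t _
            refine (le_abs_self _).trans ?_
            rw [abs_mul]
            exact mul_le_mul_of_nonneg_left (hQ _ (hZ t)) (abs_nonneg _)
        _ = _ := by rw [Finset.sum_mul]

theorem dual_poly {m d : ℕ} (f : (Fin m → Bool) → ℝ) (hf : ∀ z, f z = 1 ∨ f z = -1)
    (α₀ : ℝ) (hα₀ : 1 < α₀) (hd : 0 < d) (hdeg : IsLeast (ApproxDegSet m f α₀) d) :
    ∃ q : (Fin m → Bool) → ℝ, ∑ w, |q w| = 1 ∧
      (∀ T : Finset (Fin m), T.card < d → ∑ w, q w * ∏ i ∈ T, sg (w i) = 0) ∧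
      α₀ - 1 < (α₀ + 1) * ∑ w, q w * f w := by
  classical
  let L : (Finset (Fin m) → ℝ) →ₗ[ℝ] ((Fin m → Bool) → ℝ) :=
    { toFun := fun c z => ∑ T : Finset (Fin m), (if T.card < d then c T else 0) * ∏ i ∈ T, sg (z i)
      map_add' := by
        intro c c'; funext z
        simp only [Pi.add_apply]
        rw [← Finset.sum_add_distrib]
        apply Finset.sum_congr rfl; intro T _
        split_ifs <;> ring
      map_smul' := by
        intro r c; funext z
        simp only [Pi.smul_apply, smul_eq_mul, RingHom.id_apply]
        rw [Finset.mul_sum]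
        apply Finset.sum_congr rfl; intro T _
        split_ifs <;> ring }
  let V := LinearMap.range L
  let lo : (Fin m → Bool) → ℝ := fun z => if f z = 1 then 1 else -α₀
  let hi : (Fin m → Bool) → ℝ := fun z => if f z = 1 then α₀ else -1
  have hK : ∀ h : (Fin m → Bool) → ℝ, h ∈ Set.Icc lo hi ↔ ∀ z, 1 ≤ f z * h z ∧ f z * h z ≤ α₀ := by
    intro h
    simp only [Set.mem_Icc, Pi.le_def, ← forall_and]
    apply forall_congr'
    intro z
    rcases hf z with hz | hz
    · simp [lo, hi, hz]
    · have : ¬ ((-1:ℝ) = 1) := by norm_num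
      simp only [lo, hi, hz, this, if_false]
      constructor <;> rintro ⟨h1, h2⟩ <;> constructor <;> linarith
  have hdisj : Disjoint (Set.Icc lo hi) (V : Set ((Fin m → Bool) → ℝ)) := by
    rw [Set.disjoint_left]
    rintro h hh ⟨c, rfl⟩
    rw [hK] at hh
    have : d - 1 ∈ ApproxDegSet m f α₀ := by
      refine ⟨fun T => if T.card < d then c T else 0, ?_, hh⟩
      intro T hT
      have : ¬ T.card < d := by omega
      simp [this]
    have := hdeg.2 this
    omega
  obtain ⟨φ, u, v, h1, h2, h3⟩ := geometric_hahn_banach_compact_closed (convex_Icc lo hi)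
    isCompact_Icc V.convex V.closed_of_finiteDimensional hdisj
  have hv : v < 0 := by simpa using h3 0 V.zero_mem
  have hV : ∀ b ∈ V, φ b = 0 := by
    intro b hb
    by_contra hne
    have := h3 ((v / φ b) • b) (V.smul_mem _ hb)
    rw [map_smul, smul_eq_mul, div_mul_cancel₀ _ hne] at this
    exact lt_irrefl _ this
  let q0 : (Fin m → Bool) → ℝ := fun z => - φ (Pi.single z 1)
  have hφ : ∀ h : (Fin m → Bool) → ℝ, ∑ z, q0 z * h z = - φ h := by
    intro h
    conv_rhs => rw [pi_eq_sum_univ' h]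
    rw [map_sum, ← Finset.sum_neg_distrib]
    apply Finset.sum_congr rfl; intro z _
    rw [map_smul, smul_eq_mul]
    simp only [q0]
    ring
  have horth : ∀ T : Finset (Fin m), T.card < d → ∑ w, q0 w * ∏ i ∈ T, sg (w i) = 0 := by
    intro T hT
    rw [hφ (fun w => ∏ i ∈ T, sg (w i)), hV _ ⟨Pi.single T 1, ?_⟩, neg_zero]
    funext z
    change ∑ T' : Finset (Fin m), (if T'.card < d then (Pi.single T (1:ℝ) : Finset (Fin m) → ℝ) T'
      else 0) * ∏ i ∈ T', sg (z i) = _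
    rw [Finset.sum_eq_single T]
    · simp [hT]
    · intro T' _ hne
      simp [hne]
    · simp
  -- worst-case element
  let g : (Fin m → Bool) → ℝ := fun z => if 0 ≤ q0 z * f z then f z else α₀ * f z
  have hg : g ∈ Set.Icc lo hi := by
    rw [hK]; intro z
    simp only [g]
    split_ifs <;> rcases hf z with hz | hz <;> rw [hz] <;> constructor <;> linarith
  have hpos : 0 < ∑ z, q0 z * g z := by
    rw [hφ]
    have := h1 g hg
    linarith
  have hge : ∀ z, q0 z * g z = ((1 + α₀) * (q0 z * f z) + (1 - α₀) * |q0 z|) / 2 := by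
    intro z
    have habs : |q0 z| = |q0 z * f z| := by
      rcases hf z with hz | hz <;> rw [hz] <;> simp
    rw [habs]
    simp only [g]
    split_ifs with h
    · rw [abs_of_nonneg h]; ring
    · rw [abs_of_neg (not_le.1 h)]; ring
  have hsum : ∑ z, q0 z * g z =
      ((1 + α₀) * (∑ z, q0 z * f z) + (1 - α₀) * ∑ z, |q0 z|) / 2 := by
    simp only [hge]
    rw [← Finset.sum_div, Finset.sum_add_distrib, Finset.mul_sum, Finset.mul_sum]
  set s : ℝ := ∑ z, |q0 z| with hs
  have hs0 : 0 < s := by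
    rcases (Finset.sum_nonneg (fun z (_ : z ∈ Finset.univ) => abs_nonneg (q0 z))).lt_or_eq with h | h
    · exact h
    · exfalso
      have hz := (Finset.sum_eq_zero_iff_of_nonneg
        (fun z (_ : z ∈ Finset.univ) => abs_nonneg (q0 z))).1 h.symm
      have : ∑ z, q0 z * g z = 0 := Finset.sum_eq_zero fun z hz' => by
        rw [abs_eq_zero.1 (hz z hz'), zero_mul]
      linarith
  refine ⟨fun z => q0 z / s, ?_, ?_, ?_⟩
  · simp only [abs_div, abs_of_pos hs0]
    rw [← Finset.sum_div, ← hs, div_self hs0.ne']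
  · intro T hT
    simp only [div_mul_eq_mul_div]
    rw [← Finset.sum_div, horth T hT, zero_div]
  · simp only [div_mul_eq_mul_div]
    rw [← Finset.sum_div, ← mul_div_assoc, lt_div_iff₀ hs0]
    linarith

theorem mu_empty {n m M : ℕ} [IsEmpty (PatIdx n m M)] (A : PatIdx n m M → ℝ) (α : ℝ) :
    muAlphaP A α = 0 := by
  have h : ∀ B : PatIdx n m M → ℝ, muP B = 0 := by
    intro B
    apply le_antisymm
    · apply csInf_le
      · refine ⟨0, ?_⟩
        rintro s ⟨N, a, Z, _, _, rfl⟩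
        exact Finset.sum_nonneg fun _ _ => abs_nonneg _
      · exact ⟨0, fun _ => 0, fun _ => ∅, fun t => t.elim0, fun p => isEmptyElim p, by simp⟩
    · apply Real.sInf_nonneg
      rintro s ⟨N, a, Z, _, _, rfl⟩
      exact Finset.sum_nonneg fun _ _ => abs_nonneg _
  apply le_antisymm
  · apply Real.sInf_nonpos
    rintro s ⟨B, _, rfl⟩
    exact (h B).le
  · apply Real.sInf_nonneg
    rintro s ⟨B, _, rfl⟩
    exact (h B).ge

/-- Let `f` be a Boolean function on `m` variables with `α₀`-approximate degree `d`, and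
suppose `M ≥ 2e(k−1)2^{2^{k−1}}m/d`. Then for every `1 ≤ α < α₀ < ∞`,
`log₂ μ^α(A_{k,M,f}) ≥ d/2^{k−1} + log₂((α₀−α)/(α₀+1))`. -/
theorem stmt18 (k m M d : ℕ) (hk : 2 ≤ k) (f : (Fin m → Bool) → ℝ)
    (hf : ∀ z, f z = 1 ∨ f z = -1)
    (α α₀ : ℝ) (hα : 1 ≤ α) (hαα₀ : α < α₀)
    (hdeg : IsLeast (ApproxDegSet m f α₀) d)
    (hM : 2 * Real.exp 1 * ((k : ℝ) - 1) * 2 ^ (2 ^ (k - 1)) * (m : ℝ) / (d : ℝ) ≤ (M : ℝ)) :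
    (d : ℝ) / 2 ^ (k - 1) + Real.logb 2 ((α₀ - α) / (α₀ + 1))
      ≤ Real.logb 2 (muAlphaP (fun p : PatIdx (k - 1) m M => pattP f p) α) := by
  classical
  have hkn : 1 ≤ k - 1 := by omega
  have hkr : (k : ℝ) - 1 = ((k - 1 : ℕ) : ℝ) := by
    rw [Nat.cast_sub (by omega)]; simp
  rw [hkr] at hM
  generalize k - 1 = n at hkn hM ⊢
  have hA : ∀ p : PatIdx n m M, pattP f p = 1 ∨ pattP f p = -1 := fun p => hf _
  have hr0 : 0 < (α₀ - α) / (α₀ + 1) := div_pos (by linarith) (by linarith)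
  have hr1 : (α₀ - α) / (α₀ + 1) ≤ 1 := by
    rw [div_le_one (by linarith)]; linarith
  rcases Nat.eq_zero_or_pos d with hd | hd
  · subst hd
    have hlog : Real.logb 2 ((α₀ - α) / (α₀ + 1)) ≤ 0 :=
      Real.logb_nonpos (by norm_num) hr0.le hr1
    have hmu : 0 ≤ Real.logb 2 (muAlphaP (fun p : PatIdx n m M => pattP f p) α) := by
      rcases isEmpty_or_nonempty (PatIdx n m M) with he | ⟨⟨p0⟩⟩
      · rw [mu_empty]; simp
      · apply Real.logb_nonneg (by norm_num)
        have := mu_lower hkn (fun p : PatIdx n m M => pattP f p) α 1 1 hA hα one_pos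
          (fun p => if p = p0 then pattP f p0 else 0)
          (by
            intro Z _
            simp only [ite_mul, zero_mul, Finset.sum_ite_eq', Finset.mem_univ, if_true]
            by_cases hp : p0 ∈ Z
            · rcases hA p0 with h | h <;> simp [h, hp]
            · simp [hp])
          (by
            intro B hB
            simpa using (hB p0).1)
        simpa using this
    simp only [Nat.cast_zero, zero_div, zero_add]
    exact hlog.trans hmu
  · have hm : 0 < m := by
      rcases Nat.eq_zero_or_pos m with hm | hm
      · exfalso
        subst hm
        have : 0 ∈ ApproxDegSet 0 f α₀ := by
          refine ⟨fun _ => f default, ?_, ?_⟩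
          · intro T hT
            rw [Finset.eq_empty_of_isEmpty T] at hT
            simp at hT
          · intro z
            have hz : z = default := Subsingleton.elim _ _
            subst hz
            have e : ∀ T : Finset (Fin 0), T = ∅ := Finset.eq_empty_of_isEmpty
            simp only [e, Finset.prod_empty, mul_one]
            rcases hf default with h | h <;> rw [h] <;> simp <;> linarith
        have := hdeg.2 this
        omega
      · exact hm
    have hdr : (0:ℝ) < d := by exact_mod_cast hd
    have hmr : (0:ℝ) < m := by exact_mod_cast hm
    have hnr : (0:ℝ) < n := by exact_mod_cast hkn
    have hMr : (0:ℝ) < M := lt_of_lt_of_le (by positivity) hM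
    have hMpos : 0 < M := by exact_mod_cast hMr
    have : Nonempty (Fin M) := ⟨⟨0, hMpos⟩⟩
    obtain ⟨q, hq1, hq, hqf⟩ := dual_poly f hf α₀ (by linarith) hd hdeg
    set N : ℝ := (Fintype.card (PatIdx n m M) : ℝ) with hN
    have hNpos : 0 < N := by
      rw [hN]; exact_mod_cast Fintype.card_pos
    set r : ℝ := (α₀ - α) / (α₀ + 1) with hr
    set ε : ℝ := (2 : ℝ) ^ (-((d : ℝ) / 2 ^ n)) with hε
    have hεpos : 0 < ε := by positivity
    have key := mu_lower hkn (fun p : PatIdx n m M => pattP f p) α (N * ((1 / 2 ^ m) * r))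
      (N * ((1 / 2 ^ m) * ε)) hA hα (by positivity) (fun p => pattP q p)
      (fun Z hZ => cyl_bound hkn hMpos hd q hq1 hq hM Z hZ)
      (by
        intro B hB
        let ψ : (Fin m → Bool) → ℝ := fun z =>
          ((1 + α) * (q z * f z) + (1 - α) * |q z|) / 2
        have hψ : r ≤ ∑ z, ψ z := by
          have e : ∑ z, ψ z = ((1 + α) * (∑ z, q z * f z) + (1 - α) * ∑ z, |q z|) / 2 := by
            simp only [ψ]
            rw [← Finset.sum_div, Finset.sum_add_distrib, Finset.mul_sum, Finset.mul_sum]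
          rw [e, hq1, hr, div_le_iff₀ (by linarith)]
          nlinarith
        have hpt : ∀ p : PatIdx n m M, pattP ψ p ≤ pattP q p * B p := by
          intro p
          obtain ⟨b1, b2⟩ := hB p
          simp only [pattP, ψ] at b1 b2 ⊢
          set z : Fin m → Bool := fun i => p.1 i (fun j => p.2 j i)
          have hff : f z * f z = 1 := by rcases hf z with h | h <;> rw [h] <;> norm_num
          have habs : |q z| = |q z * f z| := by
            rcases hf z with h | h <;> rw [h] <;> simp
          have e : q z * B p = (q z * f z) * (f z * B p) := by
            calc q z * B p = q z * B p * (f z * f z) := by rw [hff, mul_one]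
              _ = _ := by ring
          rw [e, habs]
          rcases le_total 0 (q z * f z) with h | h
          · rw [abs_of_nonneg h]; nlinarith
          · rw [abs_of_nonpos h]; nlinarith
        refine le_trans ?_ (Finset.sum_le_sum fun p _ => hpt p)
        have hs : ∑ p : PatIdx n m M, pattP ψ p = N * ((1 / 2 ^ m) * ∑ z, ψ z) := by
          rw [Fintype.sum_prod_type, Finset.sum_comm]
          have e : ∀ y : Fin n → Fin m → Fin M,
              ∑ x : Fin m → (Fin n → Fin M) → Bool, pattP ψ (x, y) =
              (Fintype.card (Fin m → (Fin n → Fin M) → Bool) : ℝ) * ((1 / 2 ^ m) * ∑ z, ψ z) := by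
            intro y
            have := equidist ψ y
            simp only [pattP]
            have h2 : (0:ℝ) < 2 ^ m := by positivity
            rw [one_div_mul_eq_div, ← mul_div_assoc, eq_div_iff h2.ne', ← this, mul_comm]
          simp only [e]
          rw [Finset.sum_const, nsmul_eq_mul, Finset.card_univ, hN, Fintype.card_prod]
          push_cast
          ring
        rw [hs]
        gcongr)
    have hquot : N * ((1 / 2 ^ m) * r) / (N * ((1 / 2 ^ m) * ε)) = r / ε := by
      have : (0:ℝ) < 1 / 2 ^ m := by positivity
      rw [mul_div_mul_left _ _ hNpos.ne', mul_div_mul_left _ _ this.ne']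
    rw [hquot] at key
    have hlog : Real.logb 2 (r / ε) = (d : ℝ) / 2 ^ n + Real.logb 2 r := by
      rw [Real.logb_div hr0.ne' hεpos.ne', hε, Real.logb_rpow (by norm_num) (by norm_num)]
      ring
    rw [← hlog]
    exact Real.logb_le_logb_of_le (by norm_num) (by positivity) key
end
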